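/- Let $a\in(-1,1)$, $n\ge2$, $\tau\in\mathbb{R}$, and let $A\subset\mathbb{R}^n$ be compact. Then the $\mathscr{L}_a$-capacity of the time slice $F=A\times\{\tau\}$ equals its weighted measure: $\mathrm{cap}(F)=\int_A |y|^a\,dY$. In particular, single points have zero $\mathscr{L}_a$-capacity. -/

import Mathlib

noncomputable section
open Real MeasureTheory ENNReal

/-- The Bessel-type profile `F(z)` with `ν = (a-1)/2`:
`F(z) = e^{-z/2} ( ∑_k (z/4)^{2k}/(k! Γ(k+ν+1)) + (z/4)|z/4|^{-a} ∑_k (z/4)^{2k}/(k! Γ(k-ν+1)) )`. -/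
def Fker (a z : ℝ) : ℝ :=
  Real.exp (-z / 2) *
    ((∑' k : ℕ, (z / 4) ^ (2 * k) / ((Nat.factorial k : ℝ) * Real.Gamma ((k : ℝ) + (a - 1) / 2 + 1))) +
      z / 4 * |z / 4| ^ (-a) *
        ∑' k : ℕ, (z / 4) ^ (2 * k) / ((Nat.factorial k : ℝ) * Real.Gamma ((k : ℝ) - (a - 1) / 2 + 1)))

/-- The one-dimensional degenerate heat kernel
`ũ(x,y,t) = (4t)^{-(a+1)/2} e^{-(x-y)²/(4t)} F(xy/t)`. -/
def utilde (a x y t : ℝ) : ℝ :=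
  (4 * t) ^ (-(a + 1) / 2) * Real.exp (-(x - y) ^ 2 / (4 * t)) * Fker a (x * y / t)
/-- The fundamental solution `Γ(X,t;Y,τ)` of the degenerate parabolic operator
`𝓛_a u = D_t(|y|^a u) - div_Y(|y|^a ∇_Y u)` in spatial dimension `n = m+1 ≥ 2`:
`Γ = C_{n,a} (t-τ)^{-(n+a)/2} e^{-|X-Y|²/(4(t-τ))} F(xy/(t-τ))` for `t > τ`, and `0` otherwise,
where `x, y` are the last coordinates of `X, Y` and `C_{n,a} = 2^{-1-a}(4π)^{-(n-1)/2}`. -/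
def GammaFS (a : ℝ) (m : ℕ) (X : Fin (m + 1) → ℝ) (t : ℝ) (Y : Fin (m + 1) → ℝ) (τ : ℝ) : ℝ :=
  if τ < t then
    2 ^ (-1 - a) * (4 * π) ^ (-(m : ℝ) / 2) * (t - τ) ^ (-((m : ℝ) + 1 + a) / 2) *
      Real.exp (-(∑ i, (X i - Y i) ^ 2) / (4 * (t - τ))) *
      Fker a (X (Fin.last m) * Y (Fin.last m) / (t - τ))
  else 0

/-- The `𝓛_a`-capacity of a set `K ⊆ ℝ^{n+1}`:
`cap(K) = sup { μ(ℝ^{n+1}) : μ ∈ M⁺(K), P_μ ≤ 1 }`, where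
`P_μ(X,t) = ∫ Γ(X,t;Y,τ) dμ(Y,τ)` is the `𝓛_a`-potential of `μ`. -/
def laCap (a : ℝ) (m : ℕ) (K : Set ((Fin (m + 1) → ℝ) × ℝ)) : ℝ≥0∞ :=
  sSup {c : ℝ≥0∞ | ∃ μ : Measure ((Fin (m + 1) → ℝ) × ℝ), IsFiniteMeasure μ ∧ μ Kᶜ = 0 ∧
    (∀ X t, (∫ ζ, GammaFS a m X t ζ.1 ζ.2 ∂μ) ≤ 1) ∧ c = μ Set.univ}


/-! ### Entire series -/

lemma aux_summable (c : ℕ → ℝ) (C : ℝ) (hc : ∀ k, |c k| ≤ C / (Nat.factorial k : ℝ)) (x : ℝ) :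
    Summable fun k => c k * x ^ k := by
  have h1 : Summable fun k : ℕ => C * (|x| ^ k / (Nat.factorial k : ℝ)) :=
    (Real.summable_pow_div_factorial |x|).mul_left C
  refine Summable.of_norm_bounded h1 fun k => ?_
  rw [Real.norm_eq_abs, abs_mul, abs_pow]
  calc |c k| * |x| ^ k ≤ C / (Nat.factorial k : ℝ) * |x| ^ k := by gcongr; exact hc k
    _ = _ := by ring

lemma aux_hasDerivAt (c : ℕ → ℝ) (C : ℝ) (hc : ∀ k, |c k| ≤ C / (Nat.factorial k : ℝ)) (x : ℝ) :
    HasDerivAt (fun x => ∑' k, c k * x ^ k) (∑' k : ℕ, (k + 1 : ℝ) * c (k + 1) * x ^ k) x := by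
  set R := |x| + 1 with hR
  have hR0 : 0 < R := by positivity
  have hC : 0 ≤ C := by have := (abs_nonneg _).trans (hc 0); simpa using this
  set u : ℕ → ℝ := fun k => (k : ℝ) * (C / (Nat.factorial k : ℝ)) * R ^ (k - 1) with hu
  have hus : Summable u := by
    rw [← summable_nat_add_iff 1]
    have : Summable fun k : ℕ => C * (R ^ k / (Nat.factorial k : ℝ)) :=
      (Real.summable_pow_div_factorial R).mul_left C
    refine this.congr fun k => ?_
    simp only [hu, Nat.factorial_succ, Nat.cast_mul, Nat.cast_add, Nat.cast_one, Nat.add_sub_cancel]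
    have : (Nat.factorial k : ℝ) ≠ 0 := by positivity
    have : (k + 1 : ℝ) ≠ 0 := by positivity
    field_simp
  have hb : ∀ (n : ℕ) (y : ℝ), y ∈ Metric.ball (0 : ℝ) R → ‖c n * ((n : ℝ) * y ^ (n - 1))‖ ≤ u n := by
    intro n y hy
    have hy' : |y| ≤ R := by simpa using (Metric.mem_ball.1 hy).le
    rw [Real.norm_eq_abs, abs_mul, abs_mul, abs_pow, Nat.abs_cast]
    calc |c n| * (n * |y| ^ (n - 1)) ≤ (C / (Nat.factorial n : ℝ)) * (n * R ^ (n - 1)) := by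
          gcongr; exact hc n
      _ = _ := by simp only [hu]; ring
  have hx : x ∈ Metric.ball (0 : ℝ) R := by simp [hR]
  have h := hasDerivAt_tsum_of_isPreconnected (g := fun k x => c k * x ^ k)
    (g' := fun k y => c k * ((k : ℝ) * y ^ (k - 1))) hus Metric.isOpen_ball
    (convex_ball (0 : ℝ) R).isPreconnected
    (fun n y _ => (hasDerivAt_pow n y).const_mul (c n)) hb hx (aux_summable c C hc x) hx
  refine HasDerivAt.congr_deriv h (Eq.symm ?_)
  rw [(Summable.of_norm_bounded hus fun n => hb n x hx).tsum_eq_zero_add]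
  simp only [Nat.cast_zero, zero_mul, mul_zero, zero_add, Nat.cast_add, Nat.cast_one,
    Nat.add_sub_cancel]
  congr 1; ext k; ring

lemma gamma_lower (c : ℝ) (hc : 0 < c) :
    ∃ δ > 0, ∀ k : ℕ, δ ≤ Real.Gamma (k + c) := by
  refine ⟨min (Real.Gamma c) (Real.Gamma (1 + c)), lt_min (Real.Gamma_pos_of_pos hc)
    (Real.Gamma_pos_of_pos (by linarith)), fun k => ?_⟩
  rcases k with _ | k
  · simp
  · refine (min_le_right _ _).trans ?_
    induction k with
    | zero => simp
    | succ k ih =>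
      refine ih.trans ?_
      have : ((k + 1 + 1 : ℕ) : ℝ) + c = ((k + 1 : ℕ) + c) + 1 := by push_cast; ring
      rw [this, Real.Gamma_add_one (by positivity)]
      have h1 : 0 < Real.Gamma ((k + 1 : ℕ) + c) := Real.Gamma_pos_of_pos (by positivity)
      have h2 : 1 ≤ ((k + 1 : ℕ) : ℝ) + c := by push_cast; linarith [Nat.cast_nonneg (α := ℝ) k]
      nlinarith

/-- `Sser c q = ∑ q^k / (k! Γ(k+c))`. -/
def Sser (c q : ℝ) : ℝ := ∑' k : ℕ, q ^ k / ((Nat.factorial k : ℝ) * Real.Gamma ((k : ℝ) + c))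

def Scoef (c : ℝ) (k : ℕ) : ℝ := 1 / ((Nat.factorial k : ℝ) * Real.Gamma ((k : ℝ) + c))

lemma Scoef_pos {c : ℝ} (hc : 0 < c) (k : ℕ) : 0 < Scoef c k := by
  have : 0 < Real.Gamma ((k : ℝ) + c) := Real.Gamma_pos_of_pos (by positivity)
  unfold Scoef; positivity

lemma Scoef_bound {c : ℝ} (hc : 0 < c) :
    ∃ C, ∀ k, |Scoef c k| ≤ C / (Nat.factorial k : ℝ) := by
  obtain ⟨δ, hδ, h⟩ := gamma_lower c hc
  refine ⟨1 / δ, fun k => ?_⟩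
  rw [abs_of_pos (Scoef_pos hc k), Scoef, div_div, mul_comm]
  have := h k
  gcongr

lemma Sser_eq (c q : ℝ) : Sser c q = ∑' k, Scoef c k * q ^ k := by
  unfold Sser Scoef
  congr 1; ext k; ring

lemma Scoef_succ {c : ℝ} (k : ℕ) : ((k : ℝ) + 1) * Scoef c (k + 1) = Scoef (c + 1) k := by
  unfold Scoef
  rw [Nat.factorial_succ]
  have h1 : ((k + 1 : ℕ) : ℝ) + c = k + (c + 1) := by push_cast; ring
  rw [h1]
  push_cast
  have : (k + 1 : ℝ) ≠ 0 := by positivity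
  field_simp

lemma Sser_summable {c : ℝ} (hc : 0 < c) (q : ℝ) : Summable fun k => Scoef c k * q ^ k := by
  obtain ⟨C, hC⟩ := Scoef_bound hc
  exact aux_summable _ C hC q

lemma Sser_hasDerivAt {c : ℝ} (hc : 0 < c) (q : ℝ) : HasDerivAt (Sser c) (Sser (c + 1) q) q := by
  obtain ⟨C, hC⟩ := Scoef_bound hc
  have h := aux_hasDerivAt _ C hC q
  have e : Sser c = fun q => ∑' k, Scoef c k * q ^ k := by ext q; exact Sser_eq c q
  rw [e, Sser_eq]
  refine HasDerivAt.congr_deriv h ?_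
  congr 1; ext k
  rw [Scoef_succ]

lemma Sser_rec {c : ℝ} (hc : 0 < c) (q : ℝ) :
    Sser c q = c * Sser (c + 1) q + q * Sser (c + 2) q := by
  simp only [Sser_eq]
  rw [(Sser_summable hc q).tsum_eq_zero_add, (Sser_summable (c := c + 1) (by linarith) q).tsum_eq_zero_add,
    mul_add, ← tsum_mul_left, ← tsum_mul_left, add_assoc, ← Summable.tsum_add]
  · congr 1
    · simp only [Scoef, Nat.factorial_zero, Nat.cast_one, Nat.cast_zero, zero_add, one_mul, pow_zero, mul_one]
      rw [Real.Gamma_add_one hc.ne']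
      have := (Real.Gamma_pos_of_pos hc).ne'
      field_simp
    · congr 1; ext k
      have h1 : Scoef (c + 2) k = ((k : ℝ) + 1) * Scoef (c + 1) (k + 1) := by
        rw [Scoef_succ]; congr 1; ring
      have h2 : Scoef c (k + 1) = ((k : ℝ) + 1 + c) * Scoef (c + 1) (k + 1) := by
        unfold Scoef
        have : ((k + 1 : ℕ) : ℝ) + (c + 1) = (k + 1 + c) + 1 := by push_cast; ring
        rw [this, Real.Gamma_add_one (by positivity)]
        push_cast
        have : (0 : ℝ) < k + 1 + c := by positivity
        have := (Real.Gamma_pos_of_pos this).ne'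
        field_simp
      rw [h1, h2]; ring
  · exact ((summable_nat_add_iff 1).2 (Sser_summable (c := c + 1) (by linarith) q)).mul_left c
  · exact (Sser_summable (c := c + 2) (by linarith) q).mul_left q

lemma Sser_continuous {c : ℝ} (hc : 0 < c) : Continuous (Sser c) :=
  continuous_iff_continuousAt.2 fun q => (Sser_hasDerivAt hc q).continuousAt

lemma Sser_zero {c : ℝ} (hc : 0 < c) : Sser c 0 = 1 / Real.Gamma c := by
  rw [Sser_eq, (Sser_summable hc 0).tsum_eq_zero_add]
  simp [Scoef]

lemma Sser_pos {c : ℝ} (hc : 0 < c) {q : ℝ} (hq : 0 ≤ q) : 0 < Sser c q := by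
  rw [Sser_eq]
  refine (Sser_summable hc q).tsum_pos (fun k => ?_) 0 ?_
  · have := Scoef_pos hc k; positivity
  · have := Scoef_pos hc 0; simpa using this

lemma Sser_mono {c : ℝ} (hc : 0 < c) {p q : ℝ} (hp : 0 ≤ p) (hpq : p ≤ q) : Sser c p ≤ Sser c q := by
  simp only [Sser_eq]
  refine (Sser_summable hc p).tsum_le_tsum (fun k => ?_) (Sser_summable hc q)
  have := Scoef_pos hc k
  gcongr

/-- Wronskian. -/
lemma Sser_wronskian {b : ℝ} (hb : 0 < b) (hb1 : b < 1) (q : ℝ) :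
    Sser b q * Sser (1 - b) q - q * (Sser (b + 1) q * Sser (2 - b) q)
      = 1 / (Real.Gamma b * Real.Gamma (1 - b)) := by
  have hd : ∀ q : ℝ, HasDerivAt (fun q => Sser b q * Sser (1 - b) q - q * (Sser (b + 1) q * Sser (2 - b) q)) 0 q := by
    intro q
    have h1 := Sser_hasDerivAt hb q
    have h2 := Sser_hasDerivAt (c := 1 - b) (by linarith) q
    have h3 := Sser_hasDerivAt (c := b + 1) (by linarith) q
    have h4 := Sser_hasDerivAt (c := 2 - b) (by linarith) q
    have := (h1.mul h2).sub ((hasDerivAt_id q).mul (h3.mul h4))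
    refine HasDerivAt.congr_deriv this (Eq.symm ?_)
    have e1 := Sser_rec hb q
    have e2 := Sser_rec (c := 1 - b) (by linarith) q
    have : 1 - b + 1 = 2 - b := by ring
    rw [this] at e2 ⊢
    have : 1 - b + 2 = 2 - b + 1 := by ring
    rw [this] at e2
    have : b + 1 + 1 = b + 2 := by ring
    rw [this]
    simp only [id, Pi.mul_apply]
    rw [e1, e2]; ring
  have := is_const_of_deriv_eq_zero (f := fun q => Sser b q * Sser (1 - b) q - q * (Sser (b + 1) q * Sser (2 - b) q))
    (fun q => (hd q).differentiableAt) (fun q => (hd q).deriv) q 0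
  refine this.trans ?_
  rw [Sser_zero hb, Sser_zero (by linarith)]
  simp [mul_comm]

lemma gser_hasDerivAt {b : ℝ} (hb1 : b < 1) {q : ℝ} (hq : 0 < q) :
    HasDerivAt (fun q => q ^ (1 - b) * Sser (2 - b) q) (q ^ (-b) * Sser (1 - b) q) q := by
  have h4 := Sser_hasDerivAt (c := 2 - b) (by linarith) q
  have h := (Real.hasDerivAt_rpow_const (p := 1 - b) (Or.inl hq.ne')).mul h4
  refine HasDerivAt.congr_deriv h (Eq.symm ?_)
  rw [Sser_rec (c := 1 - b) (by linarith) q]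
  have : 1 - b + 1 = 2 - b := by ring
  rw [this]
  have : 1 - b + 2 = 2 - b + 1 := by ring
  rw [this]
  have : 1 - b - 1 = - b := by ring
  rw [this]
  have : q ^ (1 - b) = q ^ (-b) * q := by
    rw [sub_eq_neg_add, Real.rpow_add hq, Real.rpow_one]
  rw [this]; ring

lemma ratio_mono {b : ℝ} (hb : 0 < b) (hb1 : b < 1) :
    MonotoneOn (fun q => q ^ (1 - b) * Sser (2 - b) q / Sser b q) (Set.Ioi 0) := by
  have hd : ∀ q ∈ Set.Ioi (0 : ℝ), HasDerivAt (fun q => q ^ (1 - b) * Sser (2 - b) q / Sser b q)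
      (q ^ (-b) * (1 / (Real.Gamma b * Real.Gamma (1 - b))) / Sser b q ^ 2) q := by
    intro q hq
    have hq' : 0 < q := hq
    have h := (gser_hasDerivAt hb1 hq').div (Sser_hasDerivAt hb q) (Sser_pos hb hq'.le).ne'
    refine HasDerivAt.congr_deriv h (Eq.symm ?_)
    rw [← Sser_wronskian hb hb1 q]
    have : q ^ (1 - b) = q ^ (-b) * q := by
      rw [sub_eq_neg_add, Real.rpow_add hq', Real.rpow_one]
    rw [this]; ring
  refine monotoneOn_of_deriv_nonneg (convex_Ioi 0) (fun q hq => (hd q hq).continuousAt.continuousWithinAt)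
    (fun q hq => (hd q (interior_subset hq)).differentiableAt.differentiableWithinAt) ?_
  intro q hq
  have hq' : 0 < q := interior_subset hq
  rw [(hd q hq').deriv]
  have := Real.Gamma_pos_of_pos hb
  have := Real.Gamma_pos_of_pos (s := 1 - b) (by linarith)
  positivity

/-! ### Mittag-Leffler type bound -/

def Ncoef (θ : ℝ) (k : ℕ) : ℝ := 1 / Real.Gamma ((k : ℝ) + 1 + θ)

lemma Ncoef_pos {θ : ℝ} (h : 0 < θ) (k : ℕ) : 0 < Ncoef θ k := by
  have : 0 < Real.Gamma ((k : ℝ) + 1 + θ) := Real.Gamma_pos_of_pos (by positivity)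
  unfold Ncoef; positivity

lemma Ncoef_succ {θ : ℝ} (h : 0 < θ) (k : ℕ) :
    ((k : ℝ) + 1 + θ) * Ncoef θ (k + 1) = Ncoef θ k := by
  unfold Ncoef
  have e : ((k + 1 : ℕ) : ℝ) + 1 + θ = (k + 1 + θ) + 1 := by push_cast; ring
  have h0 : (0 : ℝ) < k + 1 + θ := by positivity
  rw [e, Real.Gamma_add_one h0.ne']
  have := (Real.Gamma_pos_of_pos h0).ne'
  field_simp

lemma Ncoef_bound {θ : ℝ} (h : 0 < θ) (k : ℕ) :
    |Ncoef θ k| ≤ Ncoef θ 0 / (Nat.factorial k : ℝ) := by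
  rw [abs_of_pos (Ncoef_pos h k)]
  induction k with
  | zero => simp
  | succ k ih =>
    have h1 := Ncoef_succ h k
    have h2 := Ncoef_pos h (k + 1)
    rw [Nat.factorial_succ]
    push_cast
    rw [mul_comm, ← div_div, le_div_iff₀ (by positivity)]
    refine le_trans ?_ ih
    nlinarith

lemma ML_bound {θ : ℝ} (h : 0 < θ) {x : ℝ} (hx : 0 < x) :
    x ^ θ * ∑' k, Ncoef θ k * x ^ k ≤ Real.exp x := by
  set N : ℝ → ℝ := fun x => ∑' k, Ncoef θ k * x ^ k with hN
  have hNs : ∀ x, Summable fun k => Ncoef θ k * x ^ k := fun x => aux_summable _ _ (Ncoef_bound h) x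
  have hNd : ∀ x, HasDerivAt N (∑' k : ℕ, (k + 1 : ℝ) * Ncoef θ (k + 1) * x ^ k) x :=
    fun x => aux_hasDerivAt _ _ (Ncoef_bound h) x
  have hNc : Continuous N := continuous_iff_continuousAt.2 fun x => (hNd x).continuousAt
  have hrec : ∀ x, θ * N x + x * (∑' k : ℕ, (k + 1 : ℝ) * Ncoef θ (k + 1) * x ^ k)
      = 1 / Real.Gamma θ + x * N x := by
    intro x
    have hs1 : Summable fun k : ℕ => (θ * Ncoef θ (k + 1) + (k + 1 : ℝ) * Ncoef θ (k + 1)) * x ^ (k + 1) := by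
      refine ((hNs x).mul_left x).congr fun k => ?_
      rw [← Ncoef_succ h k]; ring
    have hs2 : Summable fun k : ℕ => θ * (Ncoef θ (k + 1) * x ^ (k + 1)) :=
      ((summable_nat_add_iff 1).2 (hNs x)).mul_left θ
    have hs3 : Summable fun k : ℕ => x * ((k + 1 : ℝ) * Ncoef θ (k + 1) * x ^ k) := by
      refine (hs1.sub hs2).congr fun k => ?_
      ring
    have e1 : θ * N x = θ * Ncoef θ 0 + ∑' k : ℕ, θ * (Ncoef θ (k + 1) * x ^ (k + 1)) := by
      simp only [hN]
      rw [(hNs x).tsum_eq_zero_add, mul_add, tsum_mul_left]; simp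
    rw [e1, ← tsum_mul_left, add_assoc, ← hs2.tsum_add hs3]
    congr 1
    · simp only [Ncoef, Nat.cast_zero, zero_add]
      rw [add_comm, Real.Gamma_add_one h.ne']
      have := (Real.Gamma_pos_of_pos h).ne'
      field_simp
    · simp only [hN]
      rw [← tsum_mul_left]
      congr 1; ext k
      rw [← Ncoef_succ h k]; ring
  set F : ℝ → ℝ := fun x => Real.exp (-x) * (x ^ θ * N x) with hF
  have hFd : ∀ x, 0 < x → HasDerivAt F (1 / Real.Gamma θ * (Real.exp (-x) * x ^ (θ - 1))) x := by
    intro x hx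
    have h1 : HasDerivAt (fun x : ℝ => Real.exp (-x)) (Real.exp (-x) * (-1)) x := (hasDerivAt_neg x).exp
    have h2 := h1.mul ((Real.hasDerivAt_rpow_const (p := θ) (Or.inl hx.ne')).mul (hNd x))
    refine HasDerivAt.congr_deriv h2 ?_
    have h3 : x ^ θ = x ^ (θ - 1) * x := by
      conv_lhs => rw [show θ = (θ - 1) + 1 by ring, Real.rpow_add hx, Real.rpow_one]
    simp only [Pi.mul_apply]
    rw [h3]
    have := hrec x
    linear_combination (Real.exp (-x) * x ^ (θ - 1)) * this
  have hFc : Continuous F := by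
    have : Continuous fun x : ℝ => x ^ θ := Real.continuous_rpow_const h.le
    fun_prop
  have hInt : IntegrableOn (fun x : ℝ => Real.exp (-x) * x ^ (θ - 1)) (Set.Ioi 0) :=
    Real.GammaIntegral_convergent h
  have hii : IntervalIntegrable (fun x : ℝ => 1 / Real.Gamma θ * (Real.exp (-x) * x ^ (θ - 1))) volume 0 x := by
    rw [intervalIntegrable_iff_integrableOn_Ioc_of_le hx.le]
    exact (hInt.mono_set Set.Ioc_subset_Ioi_self).const_mul _
  have key := intervalIntegral.integral_eq_sub_of_hasDerivAt_of_le hx.le hFc.continuousOn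
    (fun y hy => hFd y hy.1) hii
  have hF0 : F 0 = 0 := by simp [hF, Real.zero_rpow h.ne']
  rw [hF0, sub_zero, intervalIntegral.integral_const_mul, intervalIntegral.integral_of_le hx.le] at key
  have hle : ∫ y in Set.Ioc 0 x, Real.exp (-y) * y ^ (θ - 1) ≤ Real.Gamma θ := by
    rw [Real.Gamma_eq_integral h]
    refine setIntegral_mono_set hInt ?_ Set.Ioc_subset_Ioi_self.eventuallyLE
    filter_upwards [ae_restrict_mem measurableSet_Ioi] with y hy
    have : (0 : ℝ) < y := hy
    simp only [Pi.zero_apply]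
    positivity
  have hG := Real.Gamma_pos_of_pos h
  have hF1 : F x ≤ 1 := by
    rw [← key, one_div, inv_mul_le_iff₀ hG]; simpa using hle
  have : x ^ θ * N x = Real.exp x * F x := by
    simp only [hF]; rw [← mul_assoc, ← Real.exp_add]; simp
  rw [this]
  nlinarith [Real.exp_pos x]

/-! ### Laplace transforms -/

lemma gamma_integrable {s r : ℝ} (hs : 0 < s) (hr : 0 < r) :
    IntegrableOn (fun q : ℝ => q ^ (s - 1) * Real.exp (-(r * q))) (Set.Ioi 0) := by
  refine Integrable.of_integral_ne_zero ?_
  rw [Real.integral_rpow_mul_exp_neg_mul_Ioi hs hr]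
  have := Real.Gamma_pos_of_pos hs
  positivity

lemma gamma_lintegral {s r : ℝ} (hs : 0 < s) (hr : 0 < r) :
    ∫⁻ q in Set.Ioi (0 : ℝ), ENNReal.ofReal (q ^ (s - 1) * Real.exp (-(r * q)))
      = ENNReal.ofReal ((1 / r) ^ s * Real.Gamma s) := by
  rw [← Real.integral_rpow_mul_exp_neg_mul_Ioi hs hr, ofReal_integral_eq_lintegral_ofReal (gamma_integrable hs hr)]
  filter_upwards [ae_restrict_mem measurableSet_Ioi] with y hy
  have : (0 : ℝ) < y := hy
  simp only [Pi.zero_apply]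
  positivity

lemma lap_general {c s r κ : ℝ} (hc : 0 < c) (hs : 0 < s) (hr : 0 < r) (hκ : 0 ≤ κ) :
    ∫⁻ q in Set.Ioi (0 : ℝ), ENNReal.ofReal (q ^ (s - 1) * Real.exp (-(r * q)) * Sser c (κ * q))
      = ∑' k : ℕ, ENNReal.ofReal (Scoef c k * κ ^ k * ((1 / r) ^ (k + s) * Real.Gamma (k + s))) := by
  have h1 : ∀ q ∈ Set.Ioi (0 : ℝ), ENNReal.ofReal (q ^ (s - 1) * Real.exp (-(r * q)) * Sser c (κ * q))
      = ∑' k : ℕ, ENNReal.ofReal (Scoef c k * κ ^ k) *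
          ENNReal.ofReal (q ^ ((k : ℝ) + s - 1) * Real.exp (-(r * q))) := by
    intro q hq
    have hq' : (0 : ℝ) < q := hq
    rw [Sser_eq, ← tsum_mul_left, ENNReal.ofReal_tsum_of_nonneg]
    · congr 1; ext k
      have := Scoef_pos hc k
      rw [← ENNReal.ofReal_mul (by positivity)]
      congr 1
      rw [show (k : ℝ) + s - 1 = (s - 1) + k by ring, Real.rpow_add hq', Real.rpow_natCast, mul_pow]
      ring
    · intro k
      have := Scoef_pos hc k
      positivity
    · exact (Sser_summable hc _).mul_left _
  rw [setLIntegral_congr_fun measurableSet_Ioi h1, lintegral_tsum]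
  · congr 1; ext k
    have := Scoef_pos hc k
    rw [lintegral_const_mul' _ _ ENNReal.ofReal_ne_top, gamma_lintegral (by positivity) hr,
      ← ENNReal.ofReal_mul (by positivity)]
  · intro k
    fun_prop

lemma lap_same {c r κ : ℝ} (hc : 0 < c) (hr : 0 < r) (hκ : 0 ≤ κ) :
    ∫⁻ q in Set.Ioi (0 : ℝ), ENNReal.ofReal (q ^ (c - 1) * Real.exp (-(r * q)) * Sser c (κ * q))
      = ENNReal.ofReal ((1 / r) ^ c * Real.exp (κ / r)) := by
  rw [lap_general hc hc hr hκ, ← ENNReal.ofReal_tsum_of_nonneg]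
  · congr 1
    rw [Real.exp_eq_exp_ℝ, NormedSpace.exp_eq_tsum_div, ← tsum_mul_left]
    congr 1; ext k
    unfold Scoef
    have := (Real.Gamma_pos_of_pos (s := k + c) (by positivity)).ne'
    rw [add_comm (k : ℝ) c] at *
    rw [Real.rpow_add (by positivity), Real.rpow_natCast, div_pow, div_pow]
    field_simp
    simp
  · intro k
    have := Scoef_pos hc k
    have := (Real.Gamma_pos_of_pos (s := k + c) (by positivity))
    positivity
  · have := (Real.summable_pow_div_factorial (κ / r)).mul_left ((1 / r) ^ c)
    refine this.congr fun k => ?_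
    unfold Scoef
    have := (Real.Gamma_pos_of_pos (s := k + c) (by positivity)).ne'
    rw [add_comm (k : ℝ) c] at *
    rw [Real.rpow_add (by positivity), Real.rpow_natCast, div_pow, div_pow]
    field_simp
    simp

lemma lap_g {b x : ℝ} (hb1 : b < 1) (hx : 0 < x) :
    ∫⁻ q in Set.Ioi (0 : ℝ), ENNReal.ofReal (Real.exp (-(1 / x * q)) * Sser (2 - b) q)
      ≤ ENNReal.ofReal (x ^ b * Real.exp x) := by
  have h := lap_general (c := 2 - b) (s := 1) (r := 1 / x) (κ := 1) (by linarith) one_pos (by positivity) zero_le_one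
  simp only [sub_self, Real.rpow_zero, one_mul, one_pow, mul_one, one_div_one_div] at h
  rw [h]
  have e : ∀ k : ℕ, Scoef (2 - b) k * (x ^ ((k : ℝ) + 1) * Real.Gamma ((k : ℝ) + 1))
      = x * (Ncoef (1 - b) k * x ^ k) := by
    intro k
    unfold Scoef Ncoef
    rw [Real.Gamma_nat_eq_factorial, Real.rpow_add hx, Real.rpow_natCast, Real.rpow_one,
      show (k : ℝ) + 1 + (1 - b) = k + (2 - b) by ring]
    field_simp
  simp_rw [e]
  rw [← ENNReal.ofReal_tsum_of_nonneg]
  · apply ENNReal.ofReal_le_ofReal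
    rw [tsum_mul_left]
    have := ML_bound (θ := 1 - b) (by linarith) hx
    calc x * ∑' k, Ncoef (1 - b) k * x ^ k = x ^ b * (x ^ (1 - b) * ∑' k, Ncoef (1 - b) k * x ^ k) := by
          rw [← mul_assoc, ← Real.rpow_add hx]; simp
      _ ≤ _ := by gcongr
  · intro k
    have := Ncoef_pos (θ := 1 - b) (by linarith) k
    positivity
  · exact (aux_summable _ _ (Ncoef_bound (by linarith)) x).mul_left x

lemma gser_le {b : ℝ} (hb : 0 < b) (hb1 : b < 1) {q₀ : ℝ} (hq₀ : 0 < q₀) :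
    q₀ ^ (1 - b) * Sser (2 - b) q₀ ≤ Sser b q₀ := by
  by_contra! hlt
  have hf0 := Sser_pos hb hq₀.le
  set r := q₀ ^ (1 - b) * Sser (2 - b) q₀ / Sser b q₀ with hr
  have hr1 : 1 < r := by rw [hr, one_lt_div hf0]; exact hlt
  have hpt : ∀ q : ℝ, 0 < q → r * Sser b q ≤ q ^ (1 - b) * Sser (2 - b) q
      + (Set.Ioc 0 q₀).indicator (fun _ => r * Sser b q₀) q := by
    intro q hq
    have hs2 := Sser_pos (c := 2 - b) (by linarith) hq.le
    rcases le_or_gt q q₀ with h | h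
    · rw [Set.indicator_of_mem (by exact ⟨hq, h⟩)]
      have := Sser_mono hb hq.le h
      have h2 : 0 ≤ q ^ (1 - b) * Sser (2 - b) q := by positivity
      nlinarith
    · rw [Set.indicator_of_notMem (by simp [h])]
      have := ratio_mono hb hb1 (Set.mem_Ioi.2 hq₀) (Set.mem_Ioi.2 hq) h.le
      simp only at this
      rw [le_div_iff₀ (Sser_pos hb hq.le)] at this
      linarith
  set D : ℝ≥0∞ := ∫⁻ q in Set.Ioi (0 : ℝ), (Set.Ioc 0 q₀).indicator
    (fun q => ENNReal.ofReal (r * Sser b q₀ * q ^ (b - 1))) q with hD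
  have hDtop : D ≠ ⊤ := by
    rw [hD, setLIntegral_indicator measurableSet_Ioc]
    rw [Set.inter_eq_left.2 Set.Ioc_subset_Ioi_self]
    have : IntegrableOn (fun q : ℝ => r * Sser b q₀ * q ^ (b - 1)) (Set.Ioc 0 q₀) := by
      rw [← intervalIntegrable_iff_integrableOn_Ioc_of_le hq₀.le]
      exact (intervalIntegral.intervalIntegrable_rpow' (by linarith)).const_mul _
    exact this.lintegral_lt_top.ne
  have hineq : ∀ x : ℝ, 0 < x → r * (x ^ b * Real.exp x) ≤ x ^ b * Real.exp x + D.toReal := by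
    intro x hx
    have h1 := lap_same (c := b) (r := 1 / x) (κ := 1) hb (by positivity) zero_le_one
    simp only [one_mul, one_div_one_div] at h1
    have h2 := lap_g hb1 hx
    have h3 : ENNReal.ofReal r * ENNReal.ofReal (x ^ b * Real.exp x) ≤
        ENNReal.ofReal (x ^ b * Real.exp x) + D := by
      rw [← h1, ← lintegral_const_mul' _ _ ENNReal.ofReal_ne_top]
      rw [h1]
      refine le_trans ?_ (add_le_add_left h2 D)
      rw [hD, ← lintegral_add_left']
      · refine setLIntegral_mono' measurableSet_Ioi fun q hq => ?_
        have hq' : (0 : ℝ) < q := hq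
        rw [← ENNReal.ofReal_mul (by linarith)]
        have e1 : (Set.Ioc 0 q₀).indicator (fun q => ENNReal.ofReal (r * Sser b q₀ * q ^ (b - 1))) q
            = ENNReal.ofReal (q ^ (b - 1) * (Set.Ioc 0 q₀).indicator (fun _ => r * Sser b q₀) q) := by
          by_cases hm : q ∈ Set.Ioc 0 q₀
          · simp only [Set.indicator_of_mem hm]; congr 1; ring
          · simp only [Set.indicator_of_notMem hm]; simp
        have hs2 := Sser_pos (c := 2 - b) (by linarith) hq'.le
        rw [e1, ← ENNReal.ofReal_add (by positivity)]
        · apply ENNReal.ofReal_le_ofReal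
          have hp := hpt q hq'
          have hE : Real.exp (-(1 / x * q)) ≤ 1 := by
            rw [Real.exp_le_one_iff]; have : 0 < 1 / x * q := by positivity
            linarith
          have hind : 0 ≤ (Set.Ioc 0 q₀).indicator (fun _ => r * Sser b q₀) q :=
            Set.indicator_nonneg (fun _ _ => by positivity) _
          have e2 : q ^ (b - 1) * q ^ (1 - b) = 1 := by
            rw [← Real.rpow_add hq']; simp
          have hqp : 0 < q ^ (b - 1) := by positivity
          have hEp := Real.exp_pos (-(1 / x * q))
          calc r * (q ^ (b - 1) * Real.exp (-(1 / x * q)) * Sser b q)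
              = (q ^ (b - 1) * Real.exp (-(1 / x * q))) * (r * Sser b q) := by ring
            _ ≤ (q ^ (b - 1) * Real.exp (-(1 / x * q))) * (q ^ (1 - b) * Sser (2 - b) q
                + (Set.Ioc 0 q₀).indicator (fun _ => r * Sser b q₀) q) := by gcongr
            _ = (q ^ (b - 1) * q ^ (1 - b)) * (Real.exp (-(1 / x * q)) * Sser (2 - b) q)
                + Real.exp (-(1 / x * q)) * (q ^ (b - 1) * (Set.Ioc 0 q₀).indicator (fun _ => r * Sser b q₀) q) := by ring
            _ ≤ _ := by
              rw [e2, one_mul]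
              have : 0 ≤ q ^ (b - 1) * (Set.Ioc 0 q₀).indicator (fun _ => r * Sser b q₀) q := by positivity
              nlinarith
        · exact mul_nonneg (by positivity) (Set.indicator_nonneg (fun _ _ => by positivity) _)
      · have := Sser_continuous (c := 2 - b) (by linarith)
        fun_prop
    have hxp : 0 < x ^ b * Real.exp x := by positivity
    rw [← ENNReal.ofReal_toReal hDtop, ← ENNReal.ofReal_mul (by linarith),
      ← ENNReal.ofReal_add hxp.le ENNReal.toReal_nonneg, ENNReal.ofReal_le_ofReal_iff (by positivity)] at h3
    exact h3
  -- contradiction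
  set x := max 1 (D.toReal / (r - 1)) with hx
  have hx1 : 1 ≤ x := le_max_left _ _
  have hx2 : D.toReal / (r - 1) ≤ x := le_max_right _ _
  have h := hineq x (by linarith)
  rw [div_le_iff₀ (by linarith)] at hx2
  have h4 : x < x ^ b * Real.exp x := by
    have h5 : 1 ≤ x ^ b := Real.one_le_rpow hx1 hb.le
    have h6 := Real.add_one_le_exp x
    nlinarith
  nlinarith

lemma gser_le' {b : ℝ} (hb : 0 < b) (hb1 : b < 1) {q : ℝ} (hq : 0 ≤ q) :
    q ^ (1 - b) * Sser (2 - b) q ≤ Sser b q := by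
  rcases hq.eq_or_lt with rfl | h
  · rw [Real.zero_rpow (by linarith), zero_mul]; exact (Sser_pos hb le_rfl).le
  · exact gser_le hb hb1 h

/-! ### One-dimensional kernel -/

lemma lap_integral {c r κ : ℝ} (hc : 0 < c) (hr : 0 < r) (hκ : 0 ≤ κ) :
    ∫ q in Set.Ioi (0 : ℝ), q ^ (c - 1) * Real.exp (-(r * q)) * Sser c (κ * q)
      = (1 / r) ^ c * Real.exp (κ / r) := by
  rw [integral_eq_lintegral_of_nonneg_ae, lap_same hc hr hκ, ENNReal.toReal_ofReal (by positivity)]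
  · filter_upwards [ae_restrict_mem measurableSet_Ioi] with y hy
    have : (0 : ℝ) < y := hy
    have := Sser_pos hc (q := κ * y) (by positivity)
    simp only [Pi.zero_apply]
    positivity
  · have := Sser_continuous hc
    have : Measurable fun q : ℝ => q ^ (c - 1) * Real.exp (-(r * q)) * Sser c (κ * q) := by fun_prop
    exact this.aestronglyMeasurable

/-- The basic even building block. -/
def Gb (c r κ x : ℝ) : ℝ := |x| ^ (2 * c - 1) * Real.exp (-(r * x ^ 2)) * Sser c (κ * x ^ 2)

lemma Gb_integral {c r κ : ℝ} (hc : 0 < c) (hr : 0 < r) (hκ : 0 ≤ κ) :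
    ∫ x, Gb c r κ x = (1 / r) ^ c * Real.exp (κ / r) := by
  have h1 := integral_comp_abs (f := fun x => Gb c r κ x)
  have h2 : ∀ x, Gb c r κ |x| = Gb c r κ x := by intro x; simp [Gb]
  simp only [h2] at h1
  have h3 := integral_comp_rpow_Ioi_of_pos (p := 2)
    (g := fun q : ℝ => q ^ (c - 1) * Real.exp (-(r * q)) * Sser c (κ * q)) two_pos
  rw [h1, ← lap_integral hc hr hκ, ← h3, ← integral_const_mul]
  refine setIntegral_congr_fun measurableSet_Ioi fun x hx => ?_
  have hx' : (0 : ℝ) < x := hx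
  simp only [Gb, smul_eq_mul, abs_of_pos hx']
  have e1 : x ^ (2 * c - 1) = x ^ ((2 : ℝ) - 1) * (x ^ (2 : ℝ)) ^ (c - 1) := by
    rw [← Real.rpow_mul hx'.le, ← Real.rpow_add hx']; congr 1; ring
  rw [e1, Real.rpow_two]; ring

lemma Gb_integrable {c r κ : ℝ} (hc : 0 < c) (hr : 0 < r) (hκ : 0 ≤ κ) : Integrable (Gb c r κ) := by
  refine Integrable.of_integral_ne_zero ?_
  rw [Gb_integral hc hr hκ]; positivity

lemma Gb_nonneg {c r κ : ℝ} (hc : 0 < c) (hκ : 0 ≤ κ) (x : ℝ) : 0 ≤ Gb c r κ x := by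
  have := Sser_pos hc (q := κ * x ^ 2) (by positivity)
  unfold Gb; positivity

def vf (a x : ℝ) : ℝ := x * |x| ^ (-a)

lemma vf_mul (a x y : ℝ) : vf a (x * y) = vf a x * vf a y := by
  unfold vf; rw [abs_mul, Real.mul_rpow (abs_nonneg _) (abs_nonneg _)]; ring

lemma vf_mul_abs (a x : ℝ) : vf a x * |x| ^ a = x := by
  unfold vf
  rcases eq_or_ne x 0 with rfl | h
  · simp
  · rw [mul_assoc, ← Real.rpow_add (abs_pos.2 h)]; simp

lemma abs_mul_rpow_abs {x s : ℝ} (hs : 1 + s ≠ 0) : |x| * |x| ^ s = |x| ^ (1 + s) := by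
  rcases eq_or_ne x 0 with rfl | h
  · simp [Real.zero_rpow hs]
  · rw [Real.rpow_add (abs_pos.2 h), Real.rpow_one]

lemma abs_vf {a : ℝ} (ha₂ : a < 1) (x : ℝ) : |vf a x| = |x| ^ (1 - a) := by
  unfold vf
  rw [abs_mul, abs_of_nonneg (Real.rpow_nonneg (abs_nonneg x) (-a)), abs_mul_rpow_abs (by linarith)]
  congr 1

lemma vf_neg (a x : ℝ) : vf a (-x) = - vf a x := by simp [vf]

lemma Fker_eq (a z : ℝ) : Fker a z = Real.exp (-z / 2) *
    (Sser ((a + 1) / 2) ((z / 4) ^ 2) + vf a (z / 4) * Sser (2 - (a + 1) / 2) ((z / 4) ^ 2)) := by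
  unfold Fker Sser vf
  congr 2
  · congr 1; ext k
    rw [pow_mul, show (k : ℝ) + (a - 1) / 2 + 1 = k + (a + 1) / 2 by ring]
  · congr 2; ext k
    rw [pow_mul, show (k : ℝ) - (a - 1) / 2 + 1 = k + (2 - (a + 1) / 2) by ring]

lemma vS_le {a : ℝ} (ha₁ : -1 < a) (ha₂ : a < 1) (w : ℝ) :
    |vf a w * Sser (2 - (a + 1) / 2) (w ^ 2)| ≤ Sser ((a + 1) / 2) (w ^ 2) := by
  have h := gser_le' (b := (a + 1) / 2) (by linarith) (by linarith) (sq_nonneg w)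
  have h2 := Sser_pos (c := 2 - (a + 1) / 2) (by linarith) (sq_nonneg w)
  rw [abs_mul, abs_of_pos h2, abs_vf ha₂]
  have : |w| ^ (1 - a) = (w ^ 2) ^ (1 - (a + 1) / 2) := by
    rw [← sq_abs, ← Real.rpow_natCast, ← Real.rpow_mul (abs_nonneg w)]
    congr 1; push_cast; ring
  rw [this]; exact h

lemma Fker_nonneg {a : ℝ} (ha₁ : -1 < a) (ha₂ : a < 1) (z : ℝ) : 0 ≤ Fker a z := by
  rw [Fker_eq]
  have := abs_le.1 (vS_le ha₁ ha₂ (z / 4))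
  have : 0 ≤ Sser ((a + 1) / 2) ((z / 4) ^ 2) + vf a (z / 4) * Sser (2 - (a + 1) / 2) ((z / 4) ^ 2) := by
    linarith [this.1]
  positivity

lemma Fker_measurable {a : ℝ} (ha₁ : -1 < a) (ha₂ : a < 1) : Measurable (Fker a) := by
  have h1 := (Sser_continuous (c := (a + 1) / 2) (by linarith)).measurable
  have h2 := (Sser_continuous (c := 2 - (a + 1) / 2) (by linarith)).measurable
  have : Fker a = fun z => _ := funext (Fker_eq a)
  rw [this]
  unfold vf
  fun_prop

/-- bound of Fker on bounded sets -/
lemma Fker_le {a : ℝ} (ha₁ : -1 < a) (ha₂ : a < 1) {z R : ℝ} (hz : |z| ≤ R) :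
    Fker a z ≤ Real.exp R * (2 * Sser ((a + 1) / 2) (R ^ 2)) := by
  rw [Fker_eq]
  have h1 := abs_le.1 (vS_le ha₁ ha₂ (z / 4))
  have hR : 0 ≤ R := (abs_nonneg z).trans hz
  have h2 : Sser ((a + 1) / 2) ((z / 4) ^ 2) ≤ Sser ((a + 1) / 2) (R ^ 2) := by
    apply Sser_mono (by linarith) (sq_nonneg _)
    rw [sq_le_sq, abs_of_nonneg hR, abs_div]
    have : |(4 : ℝ)| = 4 := by norm_num
    rw [this]; linarith [abs_nonneg z]
  have h3 : Real.exp (-z / 2) ≤ Real.exp R := by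
    apply Real.exp_le_exp.2
    have := (abs_le.1 hz).1
    linarith
  have h4 := Sser_pos (c := (a + 1) / 2) (by linarith) (sq_nonneg R)
  calc _ ≤ Real.exp (-z / 2) * (2 * Sser ((a + 1) / 2) (R ^ 2)) := by
        gcongr; linarith [h1.2]
    _ ≤ _ := by gcongr

def pker (a t y x : ℝ) : ℝ :=
  2 ^ (-1 - a) * t ^ (-(1 + a) / 2) * Real.exp (-(x - y) ^ 2 / (4 * t)) * Fker a (x * y / t) * |x| ^ a

lemma pker_nonneg {a t : ℝ} (ha₁ : -1 < a) (ha₂ : a < 1) (ht : 0 < t) (y x : ℝ) : 0 ≤ pker a t y x := by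
  have := Fker_nonneg ha₁ ha₂ (x * y / t)
  unfold pker; positivity

def Ob (a r κ' x : ℝ) : ℝ :=
  vf a κ' * x * Real.exp (-(r * x ^ 2)) * Sser (2 - (a + 1) / 2) (κ' ^ 2 * x ^ 2)

lemma Ob_neg (a r κ' x : ℝ) : Ob a r κ' (-x) = - Ob a r κ' x := by simp [Ob]

lemma Gb_neg (c r κ x : ℝ) : Gb c r κ (-x) = Gb c r κ x := by simp [Gb]

lemma integral_odd {f : ℝ → ℝ} (hf : ∀ x, f (-x) = - f x) : ∫ x, f x = 0 := by
  have h := integral_neg_eq_self f volume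
  simp only [hf, integral_neg] at h
  linarith

lemma Ob_le {a : ℝ} (ha₁ : -1 < a) (ha₂ : a < 1) (r κ' x : ℝ) :
    |Ob a r κ' x| ≤ Gb ((a + 1) / 2) r (κ' ^ 2) x := by
  have h := vS_le ha₁ ha₂ (κ' * x)
  have e : Ob a r κ' x = |x| ^ a * Real.exp (-(r * x ^ 2)) *
      (vf a (κ' * x) * Sser (2 - (a + 1) / 2) ((κ' * x) ^ 2)) := by
    unfold Ob
    rw [vf_mul, mul_pow]
    conv_lhs => rw [show vf a κ' * x = vf a κ' * (vf a x * |x| ^ a) by rw [vf_mul_abs]]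
    ring
  rw [e, abs_mul, abs_of_nonneg (by positivity : 0 ≤ |x| ^ a * Real.exp (-(r * x ^ 2)))]
  unfold Gb
  rw [show 2 * ((a + 1) / 2) - 1 = a by ring, ← mul_pow]
  gcongr

lemma pker_eq {a t : ℝ} (ht : 0 < t) (y x : ℝ) :
    pker a t y x = (1 / (4 * t)) ^ ((a + 1) / 2) * Real.exp (-(y ^ 2 / (4 * t))) *
      (Gb ((a + 1) / 2) (1 / (4 * t)) ((y / (4 * t)) ^ 2) x + Ob a (1 / (4 * t)) (y / (4 * t)) x) := by
  unfold pker
  rw [Fker_eq]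
  have e0 : (2 : ℝ) ^ (-1 - a) * t ^ (-(1 + a) / 2) = (1 / (4 * t)) ^ ((a + 1) / 2) := by
    rw [one_div, Real.inv_rpow (by positivity), ← Real.rpow_neg (by positivity),
      Real.mul_rpow (by norm_num) ht.le, show (4 : ℝ) = 2 ^ (2 : ℝ) by norm_num,
      ← Real.rpow_mul (by norm_num)]
    congr 2 <;> ring
  have e1 : x * y / t / 4 = y / (4 * t) * x := by field_simp
  have e2 : Real.exp (-(x - y) ^ 2 / (4 * t)) * Real.exp (-(x * y / t) / 2)
      = Real.exp (-(y ^ 2 / (4 * t))) * Real.exp (-(1 / (4 * t) * x ^ 2)) := by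
    rw [← Real.exp_add, ← Real.exp_add]; congr 1; field_simp; ring
  rw [e0, e1]
  unfold Gb Ob
  rw [vf_mul, show 2 * ((a + 1) / 2) - 1 = a by ring, ← mul_pow]
  set S1 := Sser ((a + 1) / 2) ((y / (4 * t) * x) ^ 2)
  set S2 := Sser (2 - (a + 1) / 2) ((y / (4 * t) * x) ^ 2)
  have e3 := vf_mul_abs a x
  calc _ = (1 / (4 * t)) ^ ((a + 1) / 2) * (Real.exp (-(x - y) ^ 2 / (4 * t)) * Real.exp (-(x * y / t) / 2))
        * (S1 * |x| ^ a + vf a (y / (4 * t)) * (vf a x * |x| ^ a) * S2) := by ring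
    _ = _ := by rw [e2, e3]; ring

section moments
lemma Gb_meas {c : ℝ} (hc : 0 < c) (r κ : ℝ) : Measurable (Gb c r κ) := by
  have h1 := (Sser_continuous hc).measurable
  unfold Gb
  fun_prop

lemma Ob_meas {a : ℝ} (ha₂ : a < 1) (r κ' : ℝ) : Measurable (Ob a r κ') := by
  have h1 := (Sser_continuous (c := 2 - (a + 1) / 2) (by linarith)).measurable
  unfold Ob
  fun_prop

lemma sq_Gb {a : ℝ} (ha₁ : -1 < a) (r κ x : ℝ) : x ^ 2 * Gb ((a + 1) / 2) r κ x
    = (a + 1) / 2 * Gb ((a + 1) / 2 + 1) r κ x + κ * Gb ((a + 1) / 2 + 2) r κ x := by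
  rcases eq_or_ne x 0 with rfl | hx
  · simp only [Gb, abs_zero]
    rw [Real.zero_rpow (x := 2 * ((a + 1) / 2 + 1) - 1) (by linarith),
      Real.zero_rpow (x := 2 * ((a + 1) / 2 + 2) - 1) (by linarith)]
    simp
  · unfold Gb
    rw [Sser_rec (c := (a + 1) / 2) (by linarith)]
    have hx' := abs_pos.2 hx
    have e1 : |x| ^ (2 * ((a + 1) / 2 + 1) - 1) = |x| ^ (2 * ((a + 1) / 2) - 1) * x ^ 2 := by
      rw [show 2 * ((a + 1) / 2 + 1) - 1 = (2 * ((a + 1) / 2) - 1) + (2 : ℕ) by push_cast; ring,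
        Real.rpow_add hx', Real.rpow_natCast, sq_abs]
    have e2 : |x| ^ (2 * ((a + 1) / 2 + 2) - 1) = |x| ^ (2 * ((a + 1) / 2) - 1) * (x ^ 2 * x ^ 2) := by
      rw [show 2 * ((a + 1) / 2 + 2) - 1 = (2 * ((a + 1) / 2) - 1) + (4 : ℕ) by push_cast; ring,
        Real.rpow_add hx', Real.rpow_natCast, ← sq_abs x]; ring
    rw [e1, e2]; ring

lemma Ob_integrable {a : ℝ} (ha₁ : -1 < a) (ha₂ : a < 1) {r : ℝ} (hr : 0 < r) (κ' : ℝ) : Integrable (Ob a r κ') := by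
  refine (Gb_integrable (c := (a + 1) / 2) (by linarith) hr (sq_nonneg κ')).mono'
    (Ob_meas ha₂ r κ').aestronglyMeasurable ?_
  filter_upwards with x
  exact Ob_le ha₁ ha₂ r κ' x

lemma sqGb_integrable {a : ℝ} (ha₁ : -1 < a) (ha₂ : a < 1) {r : ℝ} (hr : 0 < r) (κ' : ℝ) : Integrable fun x => x ^ 2 * Gb ((a + 1) / 2) r (κ' ^ 2) x := by
  simp_rw [sq_Gb ha₁]
  exact ((Gb_integrable (by linarith) hr (sq_nonneg κ')).const_mul _).add
    ((Gb_integrable (by linarith) hr (sq_nonneg κ')).const_mul _)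

lemma sqGb_integral {a : ℝ} (ha₁ : -1 < a) (ha₂ : a < 1) {r : ℝ} (hr : 0 < r) (κ' : ℝ) : ∫ x, x ^ 2 * Gb ((a + 1) / 2) r (κ' ^ 2) x
    = (1 / r) ^ ((a + 1) / 2) * Real.exp (κ' ^ 2 / r) * ((a + 1) / 2 / r + κ' ^ 2 / r ^ 2) := by
  simp_rw [sq_Gb ha₁]
  rw [integral_add ((Gb_integrable (by linarith) hr (sq_nonneg κ')).const_mul _)
    ((Gb_integrable (by linarith) hr (sq_nonneg κ')).const_mul _), integral_const_mul, integral_const_mul,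
    Gb_integral (by linarith) hr (sq_nonneg κ'), Gb_integral (by linarith) hr (sq_nonneg κ'),
    Real.rpow_add (by positivity), Real.rpow_add (by positivity), Real.rpow_one, Real.rpow_two]
  field_simp

lemma sqOb_integrable {a : ℝ} (ha₁ : -1 < a) (ha₂ : a < 1) {r : ℝ} (hr : 0 < r) (κ' : ℝ) : Integrable fun x => x ^ 2 * Ob a r κ' x := by
  refine (sqGb_integrable ha₁ ha₂ hr κ').mono'
    ((measurable_id.pow_const 2).mul (Ob_meas ha₂ r κ')).aestronglyMeasurable ?_
  filter_upwards with x
  rw [norm_mul, Real.norm_eq_abs, Real.norm_eq_abs, abs_of_nonneg (sq_nonneg x)]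
  have := Ob_le ha₁ ha₂ r κ' x
  gcongr

lemma vGb_integrable {a : ℝ} (ha₁ : -1 < a) (ha₂ : a < 1) {r : ℝ} (hr : 0 < r) (κ' : ℝ) : Integrable fun x => vf a x * Gb ((a + 1) / 2) r (κ' ^ 2) x := by
  have hm : Measurable fun x => vf a x * Gb ((a + 1) / 2) r (κ' ^ 2) x := by
    have := Gb_meas (c := (a + 1) / 2) (by linarith) r (κ' ^ 2)
    unfold vf; fun_prop
  refine ((Gb_integrable (c := (a + 1) / 2) (by linarith) hr (sq_nonneg κ')).add
    (sqGb_integrable ha₁ ha₂ hr κ')).mono' hm.aestronglyMeasurable ?_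
  filter_upwards with x
  have h0 := Gb_nonneg (c := (a + 1) / 2) (r := r) (by linarith) (sq_nonneg κ') x
  rw [norm_mul, Real.norm_eq_abs, Real.norm_eq_abs, abs_of_nonneg h0, abs_vf ha₂]
  simp only [Pi.add_apply]
  have : |x| ^ (1 - a) ≤ 1 + x ^ 2 := by
    rcases le_total |x| 1 with h | h
    · have := Real.rpow_le_one (abs_nonneg x) h (by linarith : 0 ≤ 1 - a)
      nlinarith [sq_nonneg x]
    · have := Real.rpow_le_rpow_of_exponent_le h (by linarith : 1 - a ≤ 2)
      rw [Real.rpow_two, sq_abs] at this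
      linarith
  nlinarith

lemma vOb_eq {a : ℝ} (ha₁ : -1 < a) (ha₂ : a < 1) {r : ℝ} (hr : 0 < r) (κ' : ℝ) (x : ℝ) : vf a x * Ob a r κ' x = vf a κ' * Gb (2 - (a + 1) / 2) r (κ' ^ 2) x := by
  unfold Ob Gb
  have : vf a x * x = |x| ^ (2 * (2 - (a + 1) / 2) - 1) := by
    unfold vf
    rcases eq_or_ne x 0 with rfl | hx
    · rw [abs_zero, Real.zero_rpow (x := 2 * (2 - (a + 1) / 2) - 1) (by linarith)]; simp
    · rw [show 2 * (2 - (a + 1) / 2) - 1 = (2 : ℕ) + (-a) by push_cast; ring,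
        Real.rpow_add (abs_pos.2 hx), Real.rpow_natCast, sq_abs]; ring
  rw [← this]; ring

end moments

lemma pker_moments {a t : ℝ} (ha₁ : -1 < a) (ha₂ : a < 1) (ht : 0 < t) (y : ℝ) :
    (Integrable (pker a t y) ∧ ∫ x, pker a t y x = 1) ∧
    (Integrable (fun x => x ^ 2 * pker a t y x) ∧ ∫ x, x ^ 2 * pker a t y x = y ^ 2 + 2 * (1 + a) * t) ∧
    (Integrable (fun x => vf a x * pker a t y x) ∧ ∫ x, vf a x * pker a t y x = vf a y) := by
  have hr : 0 < 1 / (4 * t) := by positivity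
  set r := 1 / (4 * t) with hr_def
  set κ' := y / (4 * t) with hκ
  set b := (a + 1) / 2 with hb
  have hb0 : 0 < b := by rw [hb]; linarith
  have e : ∀ x, pker a t y x = r ^ b * Real.exp (-(y ^ 2 / (4 * t))) * (Gb b r (κ' ^ 2) x + Ob a r κ' x) :=
    fun x => pker_eq ht y x
  have hG := Gb_integrable hb0 hr (sq_nonneg κ')
  have hO := Ob_integrable ha₁ ha₂ hr κ'
  have hG2 := sqGb_integrable ha₁ ha₂ hr κ'
  have hO2 := sqOb_integrable ha₁ ha₂ hr κ'
  have hGv := vGb_integrable ha₁ ha₂ hr κ'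
  have hOv : Integrable fun x => vf a x * Ob a r κ' x := by
    simp_rw [vOb_eq ha₁ ha₂ hr]
    exact (Gb_integrable (by linarith) hr (sq_nonneg κ')).const_mul _
  have hk : κ' ^ 2 / r = y ^ 2 / (4 * t) := by rw [hκ, hr_def]; field_simp
  have hexp : Real.exp (-(y ^ 2 / (4 * t))) * Real.exp (y ^ 2 / (4 * t)) = 1 := by
    rw [← Real.exp_add]; simp
  have hrb : r ^ b * (1 / r) ^ b = 1 := by
    rw [← Real.mul_rpow hr.le (by positivity), mul_one_div_cancel hr.ne', Real.one_rpow]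
  refine ⟨⟨?_, ?_⟩, ⟨?_, ?_⟩, ?_, ?_⟩
  · rw [show pker a t y = _ from funext e]
    exact (hG.add hO).const_mul _
  · simp_rw [e]
    rw [integral_const_mul, integral_add hG hO, Gb_integral hb0 hr (sq_nonneg κ'),
      integral_odd (Ob_neg a r κ'), hk]
    linear_combination (r ^ b * (1 / r) ^ b) * hexp + hrb
  · have e' : (fun x => x ^ 2 * pker a t y x) = fun x => (r ^ b * Real.exp (-(y ^ 2 / (4 * t)))) *
        (x ^ 2 * Gb b r (κ' ^ 2) x + x ^ 2 * Ob a r κ' x) := by ext x; rw [e]; ring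
    rw [e']; exact (hG2.add hO2).const_mul _
  · have e' : (fun x => x ^ 2 * pker a t y x) = fun x => (r ^ b * Real.exp (-(y ^ 2 / (4 * t)))) *
        (x ^ 2 * Gb b r (κ' ^ 2) x + x ^ 2 * Ob a r κ' x) := by ext x; rw [e]; ring
    rw [e', integral_const_mul, integral_add hG2 hO2, sqGb_integral ha₁ ha₂ hr,
      integral_odd (f := fun x => x ^ 2 * Ob a r κ' x) (fun x => by rw [Ob_neg]; ring), hk]
    have e3 : b / r + κ' ^ 2 / r ^ 2 = y ^ 2 + 2 * (1 + a) * t := by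
      rw [hκ, hr_def, hb]; field_simp; ring
    rw [← hb, e3]
    linear_combination (r ^ b * (1 / r) ^ b * (y ^ 2 + 2 * (1 + a) * t)) * hexp + (y ^ 2 + 2 * (1 + a) * t) * hrb
  · have e' : (fun x => vf a x * pker a t y x) = fun x => (r ^ b * Real.exp (-(y ^ 2 / (4 * t)))) *
        (vf a x * Gb b r (κ' ^ 2) x + vf a x * Ob a r κ' x) := by ext x; rw [e]; ring
    rw [e']; exact (hGv.add hOv).const_mul _
  · have e' : (fun x => vf a x * pker a t y x) = fun x => (r ^ b * Real.exp (-(y ^ 2 / (4 * t)))) *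
        (vf a x * Gb b r (κ' ^ 2) x + vf a x * Ob a r κ' x) := by ext x; rw [e]; ring
    rw [e', integral_const_mul, integral_add hGv hOv,
      integral_odd (f := fun x => vf a x * Gb b r (κ' ^ 2) x) (fun x => by rw [vf_neg, Gb_neg]; ring)]
    simp_rw [vOb_eq ha₁ ha₂ hr]
    rw [integral_const_mul, Gb_integral (by linarith) hr (sq_nonneg κ'), hk]
    have e3 : vf a κ' * (r ^ b * (1 / r) ^ (2 - (a + 1) / 2)) = vf a y := by
      have h1 : κ' = y * r := by rw [hκ, hr_def]; ring
      rw [h1, vf_mul]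
      unfold vf
      rw [abs_of_pos hr, one_div, Real.inv_rpow hr.le, ← Real.rpow_neg hr.le, ← Real.rpow_add hr]
      have : r * r ^ (-a) * r ^ (b + -(2 - (a + 1) / 2)) = 1 := by
        rw [mul_assoc, ← Real.rpow_add hr]
        nth_rewrite 1 [← Real.rpow_one r]
        rw [← Real.rpow_add hr, hb]
        ring_nf; simp
      linear_combination (y * |y| ^ (-a)) * this
    rw [zero_add]
    linear_combination (vf a κ' * (r ^ b * (1 / r) ^ (2 - (a + 1) / 2))) * hexp + e3

/-- quantitative Young inequality -/
lemma young_refined {α A B : ℝ} (h0 : 0 < α) (h1 : α < 1) (hA : 0 ≤ A) (hB : 0 ≤ B) :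
    min α (1 - α) * (A - B) ^ 2 ≤ α * A ^ 2 + (1 - α) * B ^ 2 - A ^ (2 * α) * B ^ (2 * (1 - α)) := by
  have key : ∀ {α A B : ℝ}, 0 < α → α ≤ 1 / 2 → 0 ≤ A → 0 ≤ B →
      α * (A - B) ^ 2 ≤ α * A ^ 2 + (1 - α) * B ^ 2 - A ^ (2 * α) * B ^ (2 * (1 - α)) := by
    intro α A B h0 h1 hA hB
    have h := Real.geom_mean_le_arith_mean2_weighted (w₁ := 2 * α) (w₂ := 1 - 2 * α) (p₁ := A * B) (p₂ := B ^ 2)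
      (by linarith) (by linarith) (by positivity) (by positivity) (by ring)
    have e : (A * B) ^ (2 * α) * (B ^ 2) ^ (1 - 2 * α) = A ^ (2 * α) * B ^ (2 * (1 - α)) := by
      rcases hB.eq_or_lt with rfl | hB'
      · rw [mul_zero, Real.zero_rpow (by linarith), Real.zero_rpow (x := 2 * (1 - α)) (by linarith)]; simp
      · rw [Real.mul_rpow hA hB, ← Real.rpow_natCast, ← Real.rpow_mul hB, mul_assoc, ← Real.rpow_add hB']
        congr 2; push_cast; ring
    rw [e] at h
    nlinarith
  rcases le_total α (1 / 2) with h | h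
  · rw [min_eq_left (by linarith)]; exact key h0 h hA hB
  · rw [min_eq_right (by linarith)]
    have := key (α := 1 - α) (A := B) (B := A) (by linarith) (by linarith) hB hA
    rw [show 1 - (1 - α) = α by ring] at this
    linarith

lemma korovkin {a : ℝ} (ha₁ : -1 < a) (ha₂ : a < 1) (x y : ℝ) :
    min ((1 - a) / 2) ((1 + a) / 2) / 2 * (x - y) ^ 2 ≤
      (1 - a) / 2 * x ^ 2 + (1 + a) / 2 * y ^ 2 - y * |y| ^ a * vf a x := by
  have h := young_refined (α := (1 - a) / 2) (by linarith) (by linarith) (abs_nonneg x) (abs_nonneg y)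
  rw [show 1 - (1 - a) / 2 = (1 + a) / 2 by ring, show 2 * ((1 - a) / 2) = 1 + -a by ring,
    show 2 * ((1 + a) / 2) = 1 + a by ring, ← abs_mul_rpow_abs (by linarith), ← abs_mul_rpow_abs (by linarith),
    sq_abs, sq_abs] at h
  set m := min ((1 - a) / 2) ((1 + a) / 2) with hm
  have hm0 : 0 < m := lt_min (by linarith) (by linarith)
  have hm1 : m ≤ (1 - a) / 2 := min_le_left _ _
  have hm2 : m ≤ (1 + a) / 2 := min_le_right _ _
  have hp : 0 ≤ |x| ^ (-a) * |y| ^ a := by positivity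
  unfold vf
  rcases le_total 0 (x * y) with hxy | hxy
  · have e : |x| * |y| = x * y := by rw [← abs_mul, abs_of_nonneg hxy]
    have e2 : (|x| - |y|) ^ 2 = (x - y) ^ 2 := by
      rw [sub_sq, sub_sq, sq_abs, sq_abs, mul_assoc, e]; ring
    rw [e2] at h
    have e3 : |x| * |x| ^ (-a) * (|y| * |y| ^ a) = y * |y| ^ a * (x * |x| ^ (-a)) := by
      linear_combination (|x| ^ (-a) * |y| ^ a) * e
    rw [e3] at h
    nlinarith [sq_nonneg (x - y)]
  · have : y * |y| ^ a * (x * |x| ^ (-a)) ≤ 0 := by nlinarith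
    nlinarith [sq_nonneg (x + y), sq_nonneg x, sq_nonneg y]

lemma pker_second {a t : ℝ} (ha₁ : -1 < a) (ha₂ : a < 1) (ht : 0 < t) (y : ℝ) :
    Integrable (fun x => (x - y) ^ 2 * pker a t y x) ∧
    min ((1 - a) / 2) ((1 + a) / 2) / 2 * ∫ x, (x - y) ^ 2 * pker a t y x ≤ (1 - a ^ 2) * t := by
  obtain ⟨⟨h0, i0⟩, ⟨h2, i2⟩, ⟨hv, iv⟩⟩ := pker_moments ha₁ ha₂ ht y
  set m := min ((1 - a) / 2) ((1 + a) / 2) / 2 with hm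
  have hm0 : 0 < m := by have : 0 < min ((1 - a) / 2) ((1 + a) / 2) := lt_min (by linarith) (by linarith)
                         positivity
  have hI : Integrable fun x => ((1 - a) / 2) * (x ^ 2 * pker a t y x) + ((1 + a) / 2 * y ^ 2) * pker a t y x
      - (y * |y| ^ a) * (vf a x * pker a t y x) :=
    ((h2.const_mul _).add (h0.const_mul _)).sub (hv.const_mul _)
  have hle : ∀ x, m * ((x - y) ^ 2 * pker a t y x) ≤ ((1 - a) / 2) * (x ^ 2 * pker a t y x)
      + ((1 + a) / 2 * y ^ 2) * pker a t y x - (y * |y| ^ a) * (vf a x * pker a t y x) := by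
    intro x
    have := mul_le_mul_of_nonneg_right (korovkin ha₁ ha₂ x y) (pker_nonneg ha₁ ha₂ ht y x)
    rw [← hm] at this
    linarith
  have hI2 : Integrable fun x => m * ((x - y) ^ 2 * pker a t y x) := by
    refine hI.mono' ?_ ?_
    · refine AEStronglyMeasurable.const_mul (AEStronglyMeasurable.mul ?_ h0.1) _
      exact Measurable.aestronglyMeasurable (by fun_prop)
    · filter_upwards with x
      have := pker_nonneg ha₁ ha₂ ht y x
      rw [Real.norm_eq_abs, abs_of_nonneg (by positivity)]
      exact hle x
  refine ⟨?_, ?_⟩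
  · have := hI2.const_mul m⁻¹
    refine this.congr ?_
    filter_upwards with x
    field_simp
  · rw [← integral_const_mul]
    refine (integral_mono hI2 hI hle).trans ?_
    have hs : Integrable fun x => ((1 - a) / 2) * (x ^ 2 * pker a t y x)
        + ((1 + a) / 2 * y ^ 2) * pker a t y x := (h2.const_mul _).add (h0.const_mul _)
    rw [integral_sub hs (hv.const_mul _),
      integral_add (h2.const_mul _) (h0.const_mul _), integral_const_mul, integral_const_mul,
      integral_const_mul, i0, i2, iv]
    have := vf_mul_abs a y
    apply le_of_eq
    linear_combination (-y) * this

/-! ### Multi-dimensional kernel -/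

def gk (s y x : ℝ) : ℝ := (4 * π * s) ^ (-(1 : ℝ) / 2) * Real.exp (-(x - y) ^ 2 / (4 * s))

lemma gk_eq {s : ℝ} (hs : 0 < s) (y x : ℝ) :
    gk s y x = ProbabilityTheory.gaussianPDFReal y (2 * s).toNNReal x := by
  unfold gk ProbabilityTheory.gaussianPDFReal
  rw [Real.coe_toNNReal _ (by positivity), Real.sqrt_eq_rpow, ← Real.rpow_neg (by positivity)]
  congr 2
  · ring
  · ring
  · ring

lemma gk_nonneg {s : ℝ} (hs : 0 < s) (y x : ℝ) : 0 ≤ gk s y x := by unfold gk; positivity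

lemma gk_moments {s : ℝ} (hs : 0 < s) (y : ℝ) :
    (Integrable (gk s y) ∧ ∫ x, gk s y x = 1) ∧
    (Integrable (fun x => (x - y) ^ 2 * gk s y x) ∧ ∫ x, (x - y) ^ 2 * gk s y x = 2 * s) := by
  have hv : (2 * s).toNNReal ≠ 0 := by
    rw [Ne, Real.toNNReal_eq_zero]; linarith
  have e : gk s y = ProbabilityTheory.gaussianPDFReal y (2 * s).toNNReal := funext (gk_eq hs y)
  have h2 : ∫ x, (x - y) ^ 2 * gk s y x = 2 * s := by
    have h := ProbabilityTheory.variance_fun_id_gaussianReal (μ := y) (v := (2 * s).toNNReal)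
    rw [ProbabilityTheory.variance_eq_integral (by fun_prop), ProbabilityTheory.integral_id_gaussianReal,
      ProbabilityTheory.integral_gaussianReal_eq_integral_smul hv, Real.coe_toNNReal _ (by positivity)] at h
    rw [e]
    refine Eq.trans ?_ h
    congr 1; ext x; simp [mul_comm]
  refine ⟨⟨?_, ?_⟩, ?_, h2⟩
  · rw [e]; exact ProbabilityTheory.integrable_gaussianPDFReal _ _
  · rw [e]; exact ProbabilityTheory.integral_gaussianPDFReal_eq_one _ hv
  · refine Integrable.of_integral_ne_zero ?_
    rw [h2]; positivity

lemma chebyshev {k : ℝ → ℝ} {y V ρ : ℝ} (hk : ∀ x, 0 ≤ k x) (hi : Integrable k) (h1 : ∫ x, k x = 1)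
    (hi2 : Integrable fun x => (x - y) ^ 2 * k x) (h2 : ∫ x, (x - y) ^ 2 * k x ≤ V) (hρ : 0 < ρ) :
    1 - V / ρ ^ 2 ≤ ∫ x in Metric.ball y ρ, k x := by
  rw [← integral_indicator Metric.isOpen_ball.measurableSet]
  have hle : ∀ x, k x - (ρ ^ 2)⁻¹ * ((x - y) ^ 2 * k x) ≤ (Metric.ball y ρ).indicator k x := by
    intro x
    by_cases hx : x ∈ Metric.ball y ρ
    · rw [Set.indicator_of_mem hx]
      have := hk x
      have : 0 ≤ (ρ ^ 2)⁻¹ * ((x - y) ^ 2 * k x) := by positivity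
      linarith
    · rw [Set.indicator_of_notMem hx]
      rw [Metric.mem_ball, Real.dist_eq, not_lt] at hx
      have h3 : ρ ^ 2 ≤ (x - y) ^ 2 := by rw [← sq_abs (x - y)]; gcongr
      have h4 : 1 ≤ (ρ ^ 2)⁻¹ * (x - y) ^ 2 := by
        rw [inv_mul_eq_div, one_le_div (by positivity)]; exact h3
      have := hk x
      nlinarith
  have := integral_mono (hi.sub (hi2.const_mul (ρ ^ 2)⁻¹)) (hi.indicator Metric.isOpen_ball.measurableSet) hle
  refine le_trans ?_ this
  simp only [Pi.sub_apply]
  rw [integral_sub hi (hi2.const_mul _), integral_const_mul, h1, div_eq_inv_mul]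
  gcongr

def kfac (a : ℝ) (m : ℕ) (s : ℝ) (Y : Fin (m + 1) → ℝ) (i : Fin (m + 1)) (x : ℝ) : ℝ :=
  if i = Fin.last m then pker a s (Y (Fin.last m)) x else gk s (Y i) x

def Cvar (a : ℝ) : ℝ := 2 + (1 - a ^ 2) / (min ((1 - a) / 2) ((1 + a) / 2) / 2)

lemma kfac_props {a : ℝ} (ha₁ : -1 < a) (ha₂ : a < 1) (m : ℕ) {s : ℝ} (hs : 0 < s)
    (Y : Fin (m + 1) → ℝ) (i : Fin (m + 1)) :
    (∀ x, 0 ≤ kfac a m s Y i x) ∧ Integrable (kfac a m s Y i) ∧ (∫ x, kfac a m s Y i x = 1) ∧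
    ∀ ρ > 0, 1 - Cvar a * s / ρ ^ 2 ≤ ∫ x in Metric.ball (Y i) ρ, kfac a m s Y i x := by
  have hmm : 0 < min ((1 - a) / 2) ((1 + a) / 2) / 2 := by
    have : 0 < min ((1 - a) / 2) ((1 + a) / 2) := lt_min (by linarith) (by linarith)
    positivity
  have ha3 : 0 ≤ 1 - a ^ 2 := by nlinarith
  by_cases hi : i = Fin.last m
  · subst hi
    have e : kfac a m s Y (Fin.last m) = pker a s (Y (Fin.last m)) := by ext x; simp [kfac]
    rw [e]
    obtain ⟨⟨h1, h2⟩, -⟩ := pker_moments ha₁ ha₂ hs (Y (Fin.last m))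
    obtain ⟨h3, h4⟩ := pker_second ha₁ ha₂ hs (Y (Fin.last m))
    refine ⟨pker_nonneg ha₁ ha₂ hs _, h1, h2, fun ρ hρ =>
      chebyshev (pker_nonneg ha₁ ha₂ hs _) h1 h2 h3 ?_ hρ⟩
    rw [← le_div_iff₀' hmm] at h4
    refine h4.trans ?_
    unfold Cvar
    rw [add_mul, div_mul_eq_mul_div]
    linarith
  · have e : kfac a m s Y i = gk s (Y i) := by ext x; simp [kfac, hi]
    rw [e]
    obtain ⟨⟨h1, h2⟩, h3, h4⟩ := gk_moments hs (Y i)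
    refine ⟨gk_nonneg hs _, h1, h2, fun ρ hρ =>
      chebyshev (gk_nonneg hs _) h1 h2 h3 ?_ hρ⟩
    rw [h4]
    unfold Cvar
    have : 0 ≤ (1 - a ^ 2) / (min ((1 - a) / 2) ((1 + a) / 2) / 2) := by positivity
    nlinarith

lemma GammaFS_symm (a : ℝ) (m : ℕ) (X Y : Fin (m + 1) → ℝ) (t τ : ℝ) :
    GammaFS a m X t Y τ = GammaFS a m Y t X τ := by
  unfold GammaFS
  rw [mul_comm (X (Fin.last m))]
  have : ∀ i, (X i - Y i) ^ 2 = (Y i - X i) ^ 2 := fun i => by ring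
  simp_rw [this]

lemma GammaFS_eq (a : ℝ) (m : ℕ) (X Y : Fin (m + 1) → ℝ) {t τ : ℝ} (h : τ < t) :
    |X (Fin.last m)| ^ a * GammaFS a m X t Y τ = ∏ i, kfac a m (t - τ) Y i (X i) := by
  have hs : 0 < t - τ := by linarith
  unfold GammaFS
  rw [if_pos h]
  set s := t - τ
  rw [Fin.prod_univ_castSucc]
  have e1 : ∀ i : Fin m, kfac a m s Y i.castSucc (X i.castSucc) = gk s (Y i.castSucc) (X i.castSucc) := by
    intro i; simp [kfac, Fin.castSucc_ne_last]
  have e2 : kfac a m s Y (Fin.last m) (X (Fin.last m)) = pker a s (Y (Fin.last m)) (X (Fin.last m)) := by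
    simp [kfac]
  simp only [e1, e2]
  unfold gk pker
  rw [Finset.prod_mul_distrib, Finset.prod_const, Finset.card_univ, Fintype.card_fin, ← Real.exp_sum,
    Fin.sum_univ_castSucc]
  have e3 : Real.exp (-(∑ i : Fin m, (X i.castSucc - Y i.castSucc) ^ 2 + (X (Fin.last m) - Y (Fin.last m)) ^ 2) / (4 * s))
      = Real.exp (∑ i : Fin m, -(X i.castSucc - Y i.castSucc) ^ 2 / (4 * s)) *
        Real.exp (-(X (Fin.last m) - Y (Fin.last m)) ^ 2 / (4 * s)) := by
    rw [← Real.exp_add, ← Finset.sum_div, Finset.sum_neg_distrib]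
    congr 1; ring
  have e4 : (4 * π) ^ (-(m : ℝ) / 2) * s ^ (-((m : ℝ) + 1 + a) / 2)
      = ((4 * π * s) ^ (-(1 : ℝ) / 2)) ^ m * s ^ (-(1 + a) / 2) := by
    rw [← Real.rpow_natCast, ← Real.rpow_mul (by positivity), Real.mul_rpow (by positivity) hs.le,
      mul_assoc, ← Real.rpow_add hs]
    congr 2 <;> ring
  rw [e3]
  linear_combination (|X (Fin.last m)| ^ a * 2 ^ (-1 - a) *
    (Real.exp (∑ i : Fin m, -(X i.castSucc - Y i.castSucc) ^ 2 / (4 * s)) *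
        Real.exp (-(X (Fin.last m) - Y (Fin.last m)) ^ 2 / (4 * s))) *
    Fker a (X (Fin.last m) * Y (Fin.last m) / s)) * e4

lemma GammaFS_nonneg {a : ℝ} (ha₁ : -1 < a) (ha₂ : a < 1) (m : ℕ) (X Y : Fin (m + 1) → ℝ) (t τ : ℝ) :
    0 ≤ GammaFS a m X t Y τ := by
  unfold GammaFS
  split_ifs with h
  · have hs : 0 < t - τ := by linarith
    have := Fker_nonneg ha₁ ha₂ (X (Fin.last m) * Y (Fin.last m) / (t - τ))
    positivity
  · exact le_rfl

lemma GammaFS_meas {a : ℝ} (ha₁ : -1 < a) (ha₂ : a < 1) (m : ℕ) (t : ℝ) :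
    Measurable fun p : (Fin (m + 1) → ℝ) × ((Fin (m + 1) → ℝ) × ℝ) => GammaFS a m p.1 t p.2.1 p.2.2 := by
  have hF := Fker_measurable ha₁ ha₂
  unfold GammaFS
  refine Measurable.ite (measurableSet_lt (by fun_prop) (by fun_prop)) ?_ measurable_const
  have h1 : Measurable fun p : (Fin (m + 1) → ℝ) × ((Fin (m + 1) → ℝ) × ℝ) =>
    Fker a (p.1 (Fin.last m) * p.2.1 (Fin.last m) / (t - p.2.2)) := hF.comp (by fun_prop)
  fun_prop

def wt (a : ℝ) (m : ℕ) (X : Fin (m + 1) → ℝ) : ℝ≥0∞ := ENNReal.ofReal (|X (Fin.last m)| ^ a)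

lemma wt_meas (a : ℝ) (m : ℕ) : Measurable (wt a m) := by
  unfold wt; fun_prop

lemma wt_mul {a : ℝ} (m : ℕ) (X Y : Fin (m + 1) → ℝ) {t τ : ℝ} (h : τ < t) :
    wt a m X * ENNReal.ofReal (GammaFS a m X t Y τ)
      = ENNReal.ofReal (∏ i, kfac a m (t - τ) Y i (X i)) := by
  rw [wt, ← ENNReal.ofReal_mul (by positivity), GammaFS_eq a m X Y h]

lemma prod_integrable {a : ℝ} (ha₁ : -1 < a) (ha₂ : a < 1) (m : ℕ) {s : ℝ} (hs : 0 < s)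
    (Y : Fin (m + 1) → ℝ) : Integrable fun X : Fin (m + 1) → ℝ => ∏ i, kfac a m s Y i (X i) :=
  Integrable.fintype_prod_dep (μ := fun _ => (volume : Measure ℝ))
    (f := fun i => kfac a m s Y i) fun i => (kfac_props ha₁ ha₂ m hs Y i).2.1

lemma mass_one {a : ℝ} (ha₁ : -1 < a) (ha₂ : a < 1) (m : ℕ) (Y : Fin (m + 1) → ℝ) {t τ : ℝ} (h : τ < t) :
    ∫⁻ X, wt a m X * ENNReal.ofReal (GammaFS a m X t Y τ) = 1 := by
  have hs : 0 < t - τ := by linarith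
  simp_rw [wt_mul m _ Y h]
  rw [← ofReal_integral_eq_lintegral_ofReal (prod_integrable ha₁ ha₂ m hs Y)]
  · rw [integral_fintype_prod_volume_eq_prod (fun i => kfac a m (t - τ) Y i)]
    simp [(kfac_props ha₁ ha₂ m hs Y _).2.2.1]
  · filter_upwards with X
    exact Finset.prod_nonneg fun i _ => (kfac_props ha₁ ha₂ m hs Y i).1 _

lemma mass_ball {a : ℝ} (ha₁ : -1 < a) (ha₂ : a < 1) (m : ℕ) (Y : Fin (m + 1) → ℝ) {t τ : ℝ} (h : τ < t)
    {ρ : ℝ} (hρ : 0 < ρ) (hsm : 0 ≤ 1 - Cvar a * (t - τ) / ρ ^ 2) :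
    ENNReal.ofReal ((1 - Cvar a * (t - τ) / ρ ^ 2) ^ (m + 1)) ≤
      ∫⁻ X in Metric.ball Y ρ, wt a m X * ENNReal.ofReal (GammaFS a m X t Y τ) := by
  have hs : 0 < t - τ := by linarith
  simp_rw [wt_mul m _ Y h]
  rw [← ofReal_integral_eq_lintegral_ofReal (prod_integrable ha₁ ha₂ m hs Y).integrableOn]
  · apply ENNReal.ofReal_le_ofReal
    rw [ball_pi _ hρ, volume_pi, Measure.restrict_pi_pi,
      integral_fintype_prod_eq_prod (fun i => kfac a m (t - τ) Y i)]
    calc (1 - Cvar a * (t - τ) / ρ ^ 2) ^ (m + 1)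
        = ∏ i : Fin (m + 1), (1 - Cvar a * (t - τ) / ρ ^ 2) := by simp
      _ ≤ _ := Finset.prod_le_prod (fun _ _ => hsm) fun i _ => (kfac_props ha₁ ha₂ m hs Y i).2.2.2 ρ hρ
  · filter_upwards with X
    exact Finset.prod_nonneg fun i _ => (kfac_props ha₁ ha₂ m hs Y i).1 _

def nuw (a : ℝ) (m : ℕ) : Measure (Fin (m + 1) → ℝ) := volume.withDensity (wt a m)

lemma abs_rpow_integrableOn {a : ℝ} (ha₁ : -1 < a) (R : ℝ) :
    IntegrableOn (fun x : ℝ => |x| ^ a) (Metric.closedBall 0 R) := by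
  have hb : 0 < (a + 1) / 2 := by linarith
  have h := Gb_integrable (c := (a + 1) / 2) (r := 1) (κ := 0) hb one_pos le_rfl
  have hS := Sser_pos hb (q := 0) le_rfl
  refine ((h.const_mul (Real.exp (R ^ 2) / Sser ((a + 1) / 2) 0)).integrableOn).mono'
    (Measurable.aestronglyMeasurable (by fun_prop)) ?_
  filter_upwards [ae_restrict_mem Metric.isClosed_closedBall.measurableSet] with x hx
  rw [mem_closedBall_zero_iff, Real.norm_eq_abs] at hx
  rw [Real.norm_eq_abs, abs_of_nonneg (by positivity)]
  unfold Gb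
  rw [show 2 * ((a + 1) / 2) - 1 = a by ring, zero_mul]
  have h1 : 1 ≤ Real.exp (R ^ 2) * Real.exp (-(1 * x ^ 2)) := by
    rw [← Real.exp_add, Real.one_le_exp_iff]
    have : x ^ 2 ≤ R ^ 2 := by rw [← sq_abs x]; gcongr
    linarith
  have h2 : 0 ≤ |x| ^ a := by positivity
  calc |x| ^ a ≤ |x| ^ a * (Real.exp (R ^ 2) * Real.exp (-(1 * x ^ 2))) := by nlinarith
    _ = _ := by field_simp

lemma nuw_closedBall {a : ℝ} (ha₁ : -1 < a) (m : ℕ) {R : ℝ} (hR : 0 ≤ R) :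
    nuw a m (Metric.closedBall 0 R) < ⊤ := by
  unfold nuw
  rw [withDensity_apply _ Metric.isClosed_closedBall.measurableSet, closedBall_pi _ hR, volume_pi,
    Measure.restrict_pi_pi]
  have h : Integrable (fun X : Fin (m + 1) → ℝ => ∏ i, (fun (i : Fin (m + 1)) (x : ℝ) =>
      if i = Fin.last m then |x| ^ a else 1) i (X i))
      (Measure.pi fun i => (volume : Measure ℝ).restrict (Metric.closedBall ((0 : Fin (m + 1) → ℝ) i) R)) := by
    refine Integrable.fintype_prod_dep
      (μ := fun i => (volume : Measure ℝ).restrict (Metric.closedBall ((0 : Fin (m + 1) → ℝ) i) R))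
      (f := fun (i : Fin (m + 1)) (x : ℝ) => if i = Fin.last m then |x| ^ a else 1) fun i => ?_
    by_cases hi : i = Fin.last m
    · simp only [hi, if_true]
      exact abs_rpow_integrableOn ha₁ R
    · simp only [hi, if_false]
      exact integrableOn_const (isCompact_closedBall _ _).measure_lt_top.ne
  have e : ∀ X : Fin (m + 1) → ℝ, (∏ i, (fun (i : Fin (m + 1)) (x : ℝ) =>
      if i = Fin.last m then |x| ^ a else 1) i (X i)) = |X (Fin.last m)| ^ a := by
    intro X; simp [Finset.prod_ite_eq']
  simp_rw [e] at h
  exact h.lintegral_lt_top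

lemma nuw_finite {a : ℝ} (ha₁ : -1 < a) (m : ℕ) : IsFiniteMeasureOnCompacts (nuw a m) := by
  refine ⟨fun K hK => ?_⟩
  obtain ⟨R, hR⟩ := hK.isBounded.subset_closedBall 0
  refine lt_of_le_of_lt (measure_mono (hR.trans (Metric.closedBall_subset_closedBall (le_max_left R 0)))) ?_
  exact nuw_closedBall ha₁ m (le_max_right R 0)

lemma lower_bound {a : ℝ} (ha₁ : -1 < a) (ha₂ : a < 1) (m : ℕ) (τ : ℝ)
    (A : Set (Fin (m + 1) → ℝ)) (hA : IsCompact A) :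
    nuw a m A ≤ laCap a m (A ×ˢ ({τ} : Set ℝ)) := by
  have := nuw_finite ha₁ m
  have hAm : MeasurableSet A := hA.isClosed.measurableSet
  have hf : Measurable fun Y : Fin (m + 1) → ℝ => (Y, τ) := by fun_prop
  have hfin : IsFiniteMeasure ((nuw a m).restrict A) :=
    ⟨by rw [Measure.restrict_apply_univ]; exact hA.measure_lt_top⟩
  refine le_sSup ⟨((nuw a m).restrict A).map (fun Y => (Y, τ)), inferInstance, ?_, ?_, ?_⟩
  · rw [Measure.map_apply hf (hAm.prod (measurableSet_singleton τ)).compl]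
    have : (fun Y : Fin (m + 1) → ℝ => (Y, τ)) ⁻¹' (A ×ˢ ({τ} : Set ℝ))ᶜ = Aᶜ := by
      ext Y; simp
    rw [this, Measure.restrict_apply hAm.compl]; simp
  · intro X t
    have hm : Measurable fun ζ : (Fin (m + 1) → ℝ) × ℝ => GammaFS a m X t ζ.1 ζ.2 :=
      (GammaFS_meas ha₁ ha₂ m t).comp measurable_prodMk_left
    rw [integral_map hf.aemeasurable hm.aestronglyMeasurable]
    simp only
    rcases le_or_gt t τ with h | h
    · have : ∀ Y, GammaFS a m X t Y τ = 0 := fun Y => by unfold GammaFS; rw [if_neg (not_lt.2 h)]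
      simp [this]
    · have hm' : Measurable fun Y : Fin (m + 1) → ℝ => GammaFS a m X t Y τ := hm.comp hf
      rw [integral_eq_lintegral_of_nonneg_ae (Filter.Eventually.of_forall fun Y => GammaFS_nonneg ha₁ ha₂ m X Y t τ)
        hm'.aestronglyMeasurable]
      refine ENNReal.toReal_le_of_le_ofReal zero_le_one ?_
      rw [ENNReal.ofReal_one, ← mass_one ha₁ ha₂ m X h]
      refine (setLIntegral_le_lintegral A _).trans ?_
      unfold nuw
      rw [lintegral_withDensity_eq_lintegral_mul _ (wt_meas a m) hm'.ennreal_ofReal]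
      simp only [Pi.mul_apply]
      simp_rw [GammaFS_symm a m X]
      exact le_rfl
  · rw [Measure.map_apply hf MeasurableSet.univ]; simp

lemma GammaFS_bound {a : ℝ} (ha₁ : -1 < a) (ha₂ : a < 1) (m : ℕ) (X : Fin (m + 1) → ℝ) {t τ R : ℝ} (h : τ < t) :
    ∃ C, ∀ Y : Fin (m + 1) → ℝ, ‖Y‖ ≤ R → GammaFS a m X t Y τ ≤ C := by
  have hs : 0 < t - τ := by linarith
  refine ⟨2 ^ (-1 - a) * (4 * π) ^ (-(m : ℝ) / 2) * (t - τ) ^ (-((m : ℝ) + 1 + a) / 2) * 1 *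
    (Real.exp (|X (Fin.last m)| * R / (t - τ)) * (2 * Sser ((a + 1) / 2) ((|X (Fin.last m)| * R / (t - τ)) ^ 2))),
    fun Y hY => ?_⟩
  unfold GammaFS
  rw [if_pos h]
  have h1 : |X (Fin.last m) * Y (Fin.last m) / (t - τ)| ≤ |X (Fin.last m)| * R / (t - τ) := by
    rw [abs_div, abs_mul, abs_of_pos hs]
    have : |Y (Fin.last m)| ≤ R := (norm_le_pi_norm Y (Fin.last m)).trans hY
    gcongr
  have h2 := Fker_le ha₁ ha₂ h1
  have h3 := Fker_nonneg ha₁ ha₂ (X (Fin.last m) * Y (Fin.last m) / (t - τ))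
  have h4 : Real.exp (-(∑ i, (X i - Y i) ^ 2) / (4 * (t - τ))) ≤ 1 := by
    rw [Real.exp_le_one_iff]
    have : 0 ≤ ∑ i, (X i - Y i) ^ 2 := Finset.sum_nonneg fun i _ => sq_nonneg _
    exact div_nonpos_of_nonpos_of_nonneg (by linarith) (by positivity)
  gcongr

lemma liminf_mass {a : ℝ} (ha₁ : -1 < a) (ha₂ : a < 1) (m : ℕ) (τ : ℝ) {U : Set (Fin (m + 1) → ℝ)}
    (hU : IsOpen U) {Y : Fin (m + 1) → ℝ} (hY : Y ∈ U) :
    1 ≤ Filter.liminf (fun n : ℕ => ∫⁻ X in U, wt a m X * ENNReal.ofReal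
      (GammaFS a m X (τ + 1 / ((n : ℝ) + 1)) Y τ)) Filter.atTop := by
  obtain ⟨ρ, hρ, hsub⟩ := Metric.isOpen_iff.1 hU Y hY
  have h1 : Filter.Tendsto (fun n : ℕ => 1 - Cvar a * (τ + 1 / ((n : ℝ) + 1) - τ) / ρ ^ 2) Filter.atTop (nhds 1) := by
    have h := (tendsto_one_div_add_atTop_nhds_zero_nat (𝕜 := ℝ)).const_mul (Cvar a / ρ ^ 2)
    have h' := h.const_sub 1
    rw [mul_zero, sub_zero] at h'
    refine h'.congr fun n => ?_
    ring
  have h2 : Filter.Tendsto (fun n : ℕ => ENNReal.ofReal ((1 - Cvar a * (τ + 1 / ((n : ℝ) + 1) - τ) / ρ ^ 2) ^ (m + 1)))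
      Filter.atTop (nhds 1) := by
    have := ENNReal.tendsto_ofReal (h1.pow (m + 1))
    simpa using this
  rw [← h2.liminf_eq]
  refine Filter.liminf_le_liminf ?_
  filter_upwards [h1.eventually (lt_mem_nhds zero_lt_one)] with n hn
  have ht : τ < τ + 1 / ((n : ℝ) + 1) := by
    have : 0 < 1 / ((n : ℝ) + 1) := by positivity
    linarith
  refine (mass_ball ha₁ ha₂ m Y ht hρ hn.le).trans ?_
  exact lintegral_mono_set hsub

lemma upper_bound {a : ℝ} (ha₁ : -1 < a) (ha₂ : a < 1) (m : ℕ) (τ : ℝ)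
    (A : Set (Fin (m + 1) → ℝ)) (hA : IsCompact A) :
    laCap a m (A ×ˢ ({τ} : Set ℝ)) ≤ nuw a m A := by
  have := nuw_finite ha₁ m
  refine sSup_le ?_
  rintro c ⟨μ, hμ, hK, hP, rfl⟩
  have hae : ∀ᵐ ζ ∂μ, ζ ∈ A ×ˢ ({τ} : Set ℝ) := by
    rw [ae_iff]; exact hK
  obtain ⟨R, hR⟩ := hA.isBounded.exists_norm_le
  have hPl : ∀ X t, τ < t → ∫⁻ ζ, ENNReal.ofReal (GammaFS a m X t ζ.1 ζ.2) ∂μ ≤ 1 := by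
    intro X t ht
    have hm : Measurable fun ζ : (Fin (m + 1) → ℝ) × ℝ => GammaFS a m X t ζ.1 ζ.2 :=
      (GammaFS_meas ha₁ ha₂ m t).comp measurable_prodMk_left
    obtain ⟨C, hC⟩ := GammaFS_bound ha₁ ha₂ m X (R := R) ht
    have hGint : Integrable (fun ζ : (Fin (m + 1) → ℝ) × ℝ => GammaFS a m X t ζ.1 ζ.2) μ := by
      refine (integrable_const C).mono' hm.aestronglyMeasurable ?_
      filter_upwards [hae] with ζ hζ
      obtain ⟨h1, h2⟩ := hζ
      rw [Real.norm_eq_abs, abs_of_nonneg (GammaFS_nonneg ha₁ ha₂ m _ _ _ _)]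
      rw [Set.mem_singleton_iff] at h2
      rw [h2]
      exact hC _ (hR _ h1)
    rw [← ofReal_integral_eq_lintegral_ofReal hGint
      (Filter.Eventually.of_forall fun ζ => GammaFS_nonneg ha₁ ha₂ m X ζ.1 t ζ.2)]
    rw [← ENNReal.ofReal_one]
    exact ENNReal.ofReal_le_ofReal (hP X t)
  have hU : ∀ U : Set (Fin (m + 1) → ℝ), A ⊆ U → IsOpen U → μ Set.univ ≤ nuw a m U := by
    intro U hAU hUo
    set G : ℕ → ((Fin (m + 1) → ℝ) × ℝ) → ℝ≥0∞ := fun n ζ => ∫⁻ X in U, wt a m X *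
      ENNReal.ofReal (GammaFS a m X (τ + 1 / ((n : ℝ) + 1)) ζ.1 ζ.2) with hG
    have hjoint : ∀ n : ℕ, Measurable fun p : ((Fin (m + 1) → ℝ) × ℝ) × (Fin (m + 1) → ℝ) =>
        wt a m p.2 * ENNReal.ofReal (GammaFS a m p.2 (τ + 1 / ((n : ℝ) + 1)) p.1.1 p.1.2) := by
      intro n
      exact ((wt_meas a m).comp measurable_snd).mul
        (((GammaFS_meas ha₁ ha₂ m (τ + 1 / ((n : ℝ) + 1))).comp measurable_swap).ennreal_ofReal)
    have hGm : ∀ n, Measurable (G n) := fun n => (hjoint n).lintegral_prod_right'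
    have h1 : μ Set.univ ≤ ∫⁻ ζ, Filter.liminf (fun n => G n ζ) Filter.atTop ∂μ := by
      rw [← lintegral_one]
      refine lintegral_mono_ae ?_
      filter_upwards [hae] with ζ hζ
      obtain ⟨h1, h2⟩ := hζ
      rw [Set.mem_singleton_iff] at h2
      simp only [hG, h2]
      exact liminf_mass ha₁ ha₂ m τ hUo (hAU h1)
    refine h1.trans ((lintegral_liminf_le hGm).trans ?_)
    have h2 : ∀ n, ∫⁻ ζ, G n ζ ∂μ ≤ nuw a m U := by
      intro n
      have ht : τ < τ + 1 / ((n : ℝ) + 1) := by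
        have : 0 < 1 / ((n : ℝ) + 1) := by positivity
        linarith
      simp only [hG]
      rw [lintegral_lintegral_swap (hjoint n).aemeasurable, nuw, withDensity_apply _ hUo.measurableSet]
      refine lintegral_mono fun X => ?_
      rw [lintegral_const_mul' _ _ (by simp [wt])]
      calc _ ≤ wt a m X * 1 := by gcongr; exact hPl X _ ht
        _ = _ := mul_one _
    refine (Filter.liminf_le_liminf (Filter.Eventually.of_forall h2)).trans ?_
    simp
  rw [A.measure_eq_iInf_isOpen]
  exact le_iInf fun U => le_iInf fun h1 => le_iInf fun h2 => hU U h1 h2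

/-- The `𝓛_a`-capacity of a time slice `F = A × {τ}` equals its weighted measure
`∫_A |y|^a dY`; in particular, single points have zero `𝓛_a`-capacity. -/
theorem laCap_time_slice (a : ℝ) (ha₁ : -1 < a) (ha₂ : a < 1) (m : ℕ) (hm : 1 ≤ m) (τ : ℝ)
    (A : Set (Fin (m + 1) → ℝ)) (hA : IsCompact A) :
    laCap a m (A ×ˢ ({τ} : Set ℝ)) = (∫⁻ Y in A, ENNReal.ofReal (|Y (Fin.last m)| ^ a)) ∧
      ∀ ξ : (Fin (m + 1) → ℝ) × ℝ, laCap a m {ξ} = 0 := by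
  have key : ∀ (τ : ℝ) (A : Set (Fin (m + 1) → ℝ)), IsCompact A →
      laCap a m (A ×ˢ ({τ} : Set ℝ)) = (∫⁻ Y in A, ENNReal.ofReal (|Y (Fin.last m)| ^ a)) := by
    intro τ A hA
    rw [le_antisymm (upper_bound ha₁ ha₂ m τ A hA) (lower_bound ha₁ ha₂ m τ A hA), nuw,
      withDensity_apply _ hA.isClosed.measurableSet]
    rfl
  refine ⟨key τ A hA, fun ξ => ?_⟩
  have := key ξ.2 {ξ.1} isCompact_singleton
  rw [Set.singleton_prod_singleton] at this
  rw [show ξ = (ξ.1, ξ.2) from rfl, this]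
  simp
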